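/- arXiv:1511.07251 — 3 statements merged into one kernel-verified Lean document; each statement's English description precedes it below -/
import Mathlib

section
/- For every integer d ≥ 2 there exists a sequence of distinct compact A-orbits A x_k in X = SL_d(ℝ)/SL_d(ℤ) such that every accumulation point of the form x = lim_k a_k x_k, with a_k ∈ A, satisfies x ∈ A ℤ^d (the orbit of the standard lattice). -/
open scoped Pointwise

noncomputable section

abbrev SLR (d : ℕ) := Matrix.SpecialLinearGroup (Fin d) ℝ

instance (d : ℕ) : TopologicalSpace (SLR d) := instTopologicalSpaceSubtype

def Gamma (d : ℕ) : Subgroup (SLR d) :=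
  (Matrix.SpecialLinearGroup.map (n := Fin d) (Int.castRingHom ℝ)).range

abbrev XSpace (d : ℕ) := SLR d ⧸ Gamma d

instance (d : ℕ) : MeasurableSpace (XSpace d) := borel _

def latticeOf (d : ℕ) (x : XSpace d) : Set (Fin d → ℝ) :=
  {w | ∃ g : SLR d, (QuotientGroup.mk g : XSpace d) = x ∧
      ∃ v : Fin d → ℤ, w = (g : Matrix (Fin d) (Fin d) ℝ).mulVec fun i => (v i : ℝ)}

def shortest (d : ℕ) (x : XSpace d) : ℝ :=
  sInf {r | ∃ w ∈ latticeOf d x, w ≠ 0 ∧ r = ‖w‖}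

def aSL (d : ℕ) (t : Fin d → ℝ) (ht : ∑ i, t i = 0) : SLR d :=
  ⟨Matrix.diagonal fun i => Real.exp (t i), by
    rw [Matrix.det_diagonal, ← Real.exp_sum, ht, Real.exp_zero]⟩

def Aorbit (d : ℕ) (x : XSpace d) : Set (XSpace d) :=
  {y | ∃ (t : Fin d → ℝ) (ht : ∑ i, t i = 0), y = aSL d t ht • x}

def stdLat (d : ℕ) : XSpace d := QuotientGroup.mk 1

instance SLR.instIsTopologicalGroup (d : ℕ) : IsTopologicalGroup (SLR d) where
  continuous_mul := continuous_induced_rng.2 <|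
    (continuous_subtype_val.comp continuous_fst).matrix_mul
      (continuous_subtype_val.comp continuous_snd)
  continuous_inv := continuous_induced_rng.2 <|
    (continuous_subtype_val (p := fun A : Matrix (Fin d) (Fin d) ℝ => A.det = 1)).matrix_adjugate

theorem SLR.continuous_entry (d : ℕ) (i j : Fin d) :
    Continuous fun g : SLR d => (g : Matrix (Fin d) (Fin d) ℝ) i j :=
  (continuous_subtype_val.matrix_elem i j)

theorem mem_Gamma_iff {d : ℕ} {g : SLR d} :
    g ∈ Gamma d ↔ ∀ i j, ∃ z : ℤ, (z : ℝ) = (g : Matrix (Fin d) (Fin d) ℝ) i j := by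
  constructor
  · rintro ⟨z, rfl⟩ i j
    exact ⟨(z : Matrix (Fin d) (Fin d) ℤ) i j, rfl⟩
  · intro h
    choose z hz using h
    have hmap : (Matrix.of z).map (Int.castRingHom ℝ) = (g : Matrix (Fin d) (Fin d) ℝ) := by
      ext i j
      exact hz i j
    have hdet : (Matrix.of z).det = 1 := by
      have h1 := RingHom.map_det (Int.castRingHom ℝ) (Matrix.of z)
      rw [RingHom.mapMatrix_apply, hmap, g.2, eq_intCast] at h1
      exact_mod_cast h1
    exact ⟨⟨Matrix.of z, hdet⟩, Subtype.ext hmap⟩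

theorem isClosed_Gamma (d : ℕ) : IsClosed (Gamma d : Set (SLR d)) := by
  have h : (Gamma d : Set (SLR d)) = ⋂ i, ⋂ j,
      (fun g : SLR d => (g : Matrix (Fin d) (Fin d) ℝ) i j) ⁻¹' Set.range ((↑) : ℤ → ℝ) := by
    ext g
    simp [mem_Gamma_iff]
  rw [h]
  exact isClosed_iInter fun i => isClosed_iInter fun j =>
    Int.isClosedEmbedding_coe_real.isClosed_range.preimage (SLR.continuous_entry d i j)

instance XSpace.instT2Space (d : ℕ) : T2Space (XSpace d) :=
  have : IsClosed (Gamma d : Set (SLR d)) := isClosed_Gamma d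
  inferInstance

theorem mk_eq_mk_of_mul_map {d : ℕ} {g g' : SLR d} (T : Matrix (Fin d) (Fin d) ℤ)
    (h : (g' : Matrix (Fin d) (Fin d) ℝ) = g * T.map (Int.cast : ℤ → ℝ)) :
    (QuotientGroup.mk g : XSpace d) = QuotientGroup.mk g' := by
  rw [QuotientGroup.eq, mem_Gamma_iff]
  intro i j
  refine ⟨T i j, ?_⟩
  have : ((g⁻¹ * g' : SLR d) : Matrix (Fin d) (Fin d) ℝ) = T.map (Int.cast : ℤ → ℝ) := by
    rw [Matrix.SpecialLinearGroup.coe_mul, h, ← Matrix.mul_assoc,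
      ← Matrix.SpecialLinearGroup.coe_mul, inv_mul_cancel, Matrix.SpecialLinearGroup.coe_one,
      Matrix.one_mul]
  rw [this, Matrix.map_apply]

/-- Nonzero vectors of all lattices near a given one are uniformly bounded away from zero. -/
theorem eventually_nhds_le_abs_mulVec {d : ℕ} (y : XSpace d) :
    ∃ ε : ℝ, 0 < ε ∧ ∀ᶠ z in nhds y, ∀ g : SLR d, QuotientGroup.mk g = z →
      ∀ v : Fin d → ℤ, v ≠ 0 →
        ∃ i, ε ≤ |(g : Matrix (Fin d) (Fin d) ℝ).mulVec (fun i => (v i : ℝ)) i| := by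
  obtain ⟨h, rfl⟩ := QuotientGroup.mk_surjective y
  set B : ℝ := ∑ i, ∑ j, |((h⁻¹ : SLR d) : Matrix (Fin d) (Fin d) ℝ) i j| + 1 with hB
  have hBpos : 0 < B := by positivity
  refine ⟨B⁻¹, inv_pos.2 hBpos, ?_⟩
  have hcont : Continuous fun g : SLR d =>
      ∑ i, ∑ j, |((g⁻¹ : SLR d) : Matrix (Fin d) (Fin d) ℝ) i j| :=
    continuous_finsetSum _ fun i _ => continuous_finsetSum _ fun j _ =>
      ((SLR.continuous_entry d i j).comp continuous_inv).abs
  have hev : ∀ᶠ g in nhds h, ∑ i, ∑ j, |((g⁻¹ : SLR d) : Matrix (Fin d) (Fin d) ℝ) i j| < B :=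
    hcont.continuousAt.eventually_lt continuousAt_const (lt_add_one _)
  have hopen : IsOpenMap (QuotientGroup.mk : SLR d → XSpace d) := QuotientGroup.isOpenMap_coe
  filter_upwards [hopen.image_mem_nhds hev]
  rintro _ ⟨g, hg, rfl⟩ g' hg' v hv
  obtain ⟨γ, hγ⟩ := QuotientGroup.eq.1 hg'.symm
  have hg'eq : g' = g * Matrix.SpecialLinearGroup.map (Int.castRingHom ℝ) γ := by
    rw [hγ, mul_inv_cancel_left]
  set w : Fin d → ℤ := (γ : Matrix (Fin d) (Fin d) ℤ).mulVec v with hw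
  have hw0 : w ≠ 0 := by
    intro h0
    apply hv
    have h1 : ((γ⁻¹ : Matrix.SpecialLinearGroup (Fin d) ℤ) : Matrix (Fin d) (Fin d) ℤ).mulVec w
        = v := by
      rw [hw, Matrix.mulVec_mulVec, ← Matrix.SpecialLinearGroup.coe_mul, inv_mul_cancel,
        Matrix.SpecialLinearGroup.coe_one, Matrix.one_mulVec]
    rw [← h1, h0, Matrix.mulVec_zero]
  have hcast : (fun i => (w i : ℝ)) =
      ((Matrix.SpecialLinearGroup.map (Int.castRingHom ℝ) γ : SLR d) :
        Matrix (Fin d) (Fin d) ℝ).mulVec (fun i => (v i : ℝ)) := by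
    ext i
    simp [hw, Matrix.mulVec, dotProduct, Matrix.SpecialLinearGroup.map_apply_coe]
  set u : Fin d → ℝ := (g' : Matrix (Fin d) (Fin d) ℝ).mulVec (fun i => (v i : ℝ)) with hu
  have hwu : (fun i => (w i : ℝ)) =
      ((g⁻¹ : SLR d) : Matrix (Fin d) (Fin d) ℝ).mulVec u := by
    rw [hcast, hu, Matrix.mulVec_mulVec, ← Matrix.SpecialLinearGroup.coe_mul, hg'eq,
      inv_mul_cancel_left]
  by_contra! hlt
  obtain ⟨i, hi⟩ := Function.ne_iff.1 hw0
  have h1 : (1 : ℝ) ≤ |(w i : ℝ)| := by exact_mod_cast Int.one_le_abs hi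
  have h2 : |(w i : ℝ)| ≤ ∑ j, |((g⁻¹ : SLR d) : Matrix (Fin d) (Fin d) ℝ) i j| * B⁻¹ := by
    rw [show (w i : ℝ) = _ from congrFun hwu i, Matrix.mulVec, dotProduct]
    refine (Finset.abs_sum_le_sum_abs _ _).trans (Finset.sum_le_sum fun j _ => ?_)
    rw [abs_mul]
    exact mul_le_mul_of_nonneg_left (hlt j).le (abs_nonneg _)
  have h3 : ∑ j, |((g⁻¹ : SLR d) : Matrix (Fin d) (Fin d) ℝ) i j| ≤
      ∑ i, ∑ j, |((g⁻¹ : SLR d) : Matrix (Fin d) (Fin d) ℝ) i j| :=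
    Finset.single_le_sum (f := fun i => ∑ j, |((g⁻¹ : SLR d) : Matrix (Fin d) (Fin d) ℝ) i j|)
      (fun i _ => Finset.sum_nonneg fun j _ => abs_nonneg _) (Finset.mem_univ i)
  rw [← Finset.sum_mul] at h2
  have h4 : (∑ j, |((g⁻¹ : SLR d) : Matrix (Fin d) (Fin d) ℝ) i j|) * B⁻¹ < 1 := by
    rw [← div_eq_mul_inv, div_lt_one hBpos]
    exact h3.trans_lt hg
  linarith

theorem coe_aSL_mul {d : ℕ} (t : Fin d → ℝ) (ht : ∑ i, t i = 0) (g : SLR d) (i j : Fin d) :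
    ((aSL d t ht * g : SLR d) : Matrix (Fin d) (Fin d) ℝ) i j
      = Real.exp (t i) * (g : Matrix (Fin d) (Fin d) ℝ) i j := by
  rw [Matrix.SpecialLinearGroup.coe_mul, aSL, Matrix.diagonal_mul]

theorem aSL_smul_mk {d : ℕ} (t : Fin d → ℝ) (ht : ∑ i, t i = 0) (g : SLR d) :
    aSL d t ht • (QuotientGroup.mk g : XSpace d) = QuotientGroup.mk (aSL d t ht * g) := rfl

theorem not_isCompact_Aorbit_stdLat {d : ℕ} (hd : 2 ≤ d) : ¬ IsCompact (Aorbit d (stdLat d)) := by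
  intro hc
  let i₀ : Fin d := ⟨0, by omega⟩
  let i₁ : Fin d := ⟨1, by omega⟩
  have hne : i₁ ≠ i₀ := by simp [i₀, i₁]
  let t : ℕ → Fin d → ℝ := fun k => Pi.single i₁ (k : ℝ) - Pi.single i₀ (k : ℝ)
  have ht : ∀ k, ∑ i, t k i = 0 := fun k => by simp [t]
  obtain ⟨y, -, hy⟩ := hc.exists_mapClusterPt (f := (Filter.atTop : Filter ℕ))
    (u := fun k => aSL d (t k) (ht k) • stdLat d)
    (Filter.tendsto_principal.2 (Filter.Eventually.of_forall fun k => ⟨t k, ht k, rfl⟩))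
  obtain ⟨ε, hε, hev⟩ := eventually_nhds_le_abs_mulVec y
  have hlim : ∀ᶠ k : ℕ in Filter.atTop, Real.exp (-(k : ℝ)) < ε :=
    (Real.tendsto_exp_neg_atTop_nhds_zero.comp tendsto_natCast_atTop_atTop).eventually_lt_const hε
  have hfr : ∃ᶠ k in Filter.atTop, ∀ g : SLR d,
      QuotientGroup.mk g = aSL d (t k) (ht k) • stdLat d → ∀ v : Fin d → ℤ, v ≠ 0 →
        ∃ i, ε ≤ |(g : Matrix (Fin d) (Fin d) ℝ).mulVec (fun i => (v i : ℝ)) i| :=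
    hy.frequently hev
  obtain ⟨k, hk, hk'⟩ := (hfr.and_eventually hlim).exists
  obtain ⟨i, hi⟩ := hk (aSL d (t k) (ht k) * 1) (aSL_smul_mk _ _ _).symm (Pi.single i₀ 1)
    (by simp)
  have hcast : (fun i => ((Pi.single i₀ 1 : Fin d → ℤ) i : ℝ)) = Pi.single i₀ 1 := by
    ext i
    by_cases h : i = i₀ <;> simp [h]
  rw [hcast, Matrix.mulVec_single_one, Matrix.col_apply, coe_aSL_mul] at hi
  by_cases h : i = i₀
  · subst h
    simp [t, hne.symm] at hi
    linarith
  · simp [h] at hi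
    linarith

/-- `θ` lists the roots of `∏ i, (X - n i) - 1`, the `j`-th one lying within `1` of `n j`. -/
structure IsCasselsRoots (d n : ℕ) (θ : Fin d → ℝ) : Prop where
  prod_sub : ∀ j, ∏ i : Fin d, (θ j - n * (i : ℕ)) = 1
  abs_sub_le : ∀ j, |θ j - n * (j : ℕ)| ≤ 1

theorem sub_one_le_abs_sub_mul {n i j : ℕ} {x : ℝ} (hx : |x - n * j| ≤ 1) (hij : i ≠ j) :
    (n : ℝ) - 1 ≤ |x - n * i| := by
  have h1 : (1 : ℝ) ≤ |(j : ℝ) - i| := by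
    have : (1 : ℤ) ≤ |(j : ℤ) - i| := Int.one_le_abs (by omega)
    exact_mod_cast this
  have h2 : (n : ℝ) ≤ |(n : ℝ) * j - n * i| := by
    rw [← mul_sub, abs_mul, abs_of_nonneg (Nat.cast_nonneg n)]
    exact le_mul_of_one_le_right (Nat.cast_nonneg n) h1
  have h3 : |(n : ℝ) * j - n * i| ≤ |x - n * i| + |x - n * j| := by
    have := abs_sub (x - n * i) (x - n * j)
    rwa [show x - n * i - (x - n * j) = (n : ℝ) * j - n * i by ring] at this
  linarith

theorem exists_root_near (d : ℕ) {n : ℕ} (hn : 2 ≤ n) (j : Fin d) :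
    ∃ x : ℝ, ∏ i : Fin d, (x - n * (i : ℕ)) = 1 ∧ |x - n * (j : ℕ)| ≤ 1 := by
  set a : ℝ := n * (j : ℕ) with ha
  set Q : ℝ → ℝ := fun x => ∏ i ∈ Finset.univ.erase j, (x - n * (i : ℕ)) with hQ
  have hn' : (2 : ℝ) ≤ n := by exact_mod_cast hn
  have hfac : ∀ x : ℝ, ∏ i : Fin d, (x - n * (i : ℕ)) = (x - a) * Q x := fun x =>
    (Finset.mul_prod_erase Finset.univ _ (Finset.mem_univ j)).symm
  have hQc : Continuous Q := by fun_prop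
  have hQ1 : ∀ x : ℝ, |x - a| ≤ 1 → 1 ≤ |Q x| := by
    intro x hx
    rw [hQ, Finset.abs_prod]
    refine Finset.one_le_prod fun i hi => ?_
    have := sub_one_le_abs_sub_mul hx fun h => (Finset.mem_erase.1 hi).1 (Fin.ext h)
    linarith
  simp only [hfac]
  rcases le_abs.1 (hQ1 (a + 1) (by simp)) with h | h
  · obtain ⟨x, hx, hx1⟩ := intermediate_value_Icc (show a ≤ a + 1 by linarith)
      (f := fun x => (x - a) * Q x) (by fun_prop) (show (1 : ℝ) ∈ _ by simpa using h)
    exact ⟨x, hx1, abs_le.2 ⟨by linarith [hx.1], by linarith [hx.2]⟩⟩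
  · have hneg : Q (a - 1) ≤ -1 := by
      rcases le_abs.1 (hQ1 (a - 1) (by simp)) with h' | h'
      · obtain ⟨x, hx, hx0⟩ := intermediate_value_Icc' (show a - 1 ≤ a + 1 by linarith)
          hQc.continuousOn (show (0 : ℝ) ∈ _ from ⟨by linarith, by linarith⟩)
        have := hQ1 x (abs_le.2 ⟨by linarith [hx.1], by linarith [hx.2]⟩)
        rw [hx0, abs_zero] at this
        linarith
      · linarith
    obtain ⟨x, hx, hx1⟩ := intermediate_value_Icc' (show a - 1 ≤ a by linarith)
      (f := fun x => (x - a) * Q x) (by fun_prop)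
      (show (1 : ℝ) ∈ _ from ⟨by simp, by simp; linarith⟩)
    exact ⟨x, hx1, abs_le.2 ⟨by linarith [hx.1], by linarith [hx.2]⟩⟩

theorem exists_isCasselsRoots (d : ℕ) {n : ℕ} (hn : 2 ≤ n) : ∃ θ, IsCasselsRoots d n θ := by
  choose θ h1 h2 using fun j => exists_root_near d hn j
  exact ⟨θ, h1, h2⟩

namespace IsCasselsRoots

variable {d n : ℕ} {θ : Fin d → ℝ}

theorem half_le_abs_sub (h : IsCasselsRoots d n θ) (hn : 4 ≤ n) {i j : Fin d} (hij : i ≠ j) :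
    (n : ℝ) / 2 ≤ |θ j - n * (i : ℕ)| := by
  have hn' : (4 : ℝ) ≤ n := by exact_mod_cast hn
  have := sub_one_le_abs_sub_mul (h.abs_sub_le j) fun e => hij (Fin.ext e)
  linarith

theorem abs_sub_le_mul (h : IsCasselsRoots d n θ) (hn : 4 ≤ n) (i j : Fin d) :
    |θ j - n * (i : ℕ)| ≤ d * n := by
  have hn' : (4 : ℝ) ≤ n := by exact_mod_cast hn
  have h1 : |((j : ℕ) : ℝ) - (i : ℕ)| ≤ d - 1 := by
    have : |((j : ℕ) : ℤ) - (i : ℕ)| ≤ d - 1 := by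
      rw [abs_le]
      have := i.2
      have := j.2
      omega
    exact_mod_cast this
  have h2 : |θ j - n * (i : ℕ)| ≤ |θ j - n * (j : ℕ)| + n * |((j : ℕ) : ℝ) - (i : ℕ)| := by
    rw [← abs_of_nonneg (Nat.cast_nonneg (α := ℝ) n), ← abs_mul,
      abs_of_nonneg (Nat.cast_nonneg (α := ℝ) n)]
    refine le_trans (le_of_eq ?_) (abs_add_le _ _)
    congr 1
    ring
  have h3 := mul_le_mul_of_nonneg_left h1 (Nat.cast_nonneg (α := ℝ) n)
  have h4 := h.abs_sub_le j
  nlinarith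

theorem half_le_sub (h : IsCasselsRoots d n θ) (hn : 4 ≤ n) {i j : Fin d} (hij : i < j) :
    (n : ℝ) / 2 ≤ θ j - θ i := by
  have hn' : (4 : ℝ) ≤ n := by exact_mod_cast hn
  have h1 : ((i : ℕ) : ℝ) + 1 ≤ (j : ℕ) := by exact_mod_cast hij
  have h2 := mul_le_mul_of_nonneg_left h1 (Nat.cast_nonneg (α := ℝ) n)
  have h3 := (abs_le.1 (h.abs_sub_le i)).2
  have h4 := (abs_le.1 (h.abs_sub_le j)).1
  linarith

theorem strictMono (h : IsCasselsRoots d n θ) (hn : 4 ≤ n) : StrictMono θ := by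
  intro i j hij
  have hn' : (4 : ℝ) ≤ n := by exact_mod_cast hn
  linarith [h.half_le_sub hn hij]

theorem sub_ne_zero (h : IsCasselsRoots d n θ) (i j : Fin d) : θ j - n * (i : ℕ) ≠ 0 := by
  intro h0
  have := h.prod_sub j
  rw [Finset.prod_eq_zero (Finset.mem_univ i) h0] at this
  exact zero_ne_one this

open Polynomial in
/-- The values at `θ` of an integer polynomial are integral combinations of the powers of `θ`. -/
theorem exists_aeval_eq_sum (h : IsCasselsRoots d n θ) (hd : 0 < d) (P : ℤ[X]) :
    ∃ w : Fin d → ℤ, ∀ j, aeval (θ j) P = ∑ m : Fin d, θ j ^ (m : ℕ) * (w m : ℝ) := by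
  set q : ℤ[X] := ∏ i : Fin d, (X - C ((n : ℤ) * (i : ℕ))) with hq
  have hqm : q.Monic := monic_prod_of_monic _ _ fun i _ => monic_X_sub_C _
  have hqd : q.natDegree = d := by
    rw [hq, natDegree_prod_of_monic _ _ fun i _ => monic_X_sub_C _]
    simp only [natDegree_X_sub_C, Finset.sum_const, Finset.card_univ, Fintype.card_fin,
      smul_eq_mul, mul_one]
  have hlt : (1 : ℤ[X]).degree < q.degree := by
    rw [degree_one, degree_eq_natDegree hqm.ne_zero, hqd]
    exact_mod_cast hd
  set f : ℤ[X] := q - 1 with hf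
  have hfm : f.Monic := hqm.sub_of_left hlt
  have hfd : f.natDegree = d := by
    rw [hf, natDegree_sub_eq_left_of_natDegree_lt (by rw [natDegree_one, hqd]; exact hd), hqd]
  have hroot : ∀ j, aeval (θ j) f = 0 := by
    intro j
    have := h.prod_sub j
    simp only [hf, hq, map_sub, map_prod, aeval_X, map_one, aeval_C]
    simp only [algebraMap_int_eq, eq_intCast, Int.cast_natCast, Int.cast_mul]
    rw [this, sub_self]
  have hdeg : (P %ₘ f).natDegree < d := by
    have := natDegree_modByMonic_lt P hfm (fun h1 => by rw [h1, natDegree_one] at hfd; omega)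
    omega
  refine ⟨fun m => (P %ₘ f).coeff m, fun j => ?_⟩
  conv_lhs => rw [← modByMonic_add_div P f]
  rw [map_add, map_mul, hroot, zero_mul, add_zero, aeval_eq_sum_range' hdeg,
    Finset.sum_range]
  refine Finset.sum_congr rfl fun m _ => ?_
  rw [zsmul_eq_mul, mul_comm]

open Polynomial in
theorem prod_abs_sub (h : IsCasselsRoots d n θ) (hn : 4 ≤ n) (i : Fin d) :
    ∏ j, |θ j - n * (i : ℕ)| = 1 := by
  have hd : 0 < d := i.pos
  have key : (∏ i : Fin d, (X - C ((n : ℝ) * (i : ℕ))) - 1 : ℝ[X]) = ∏ j, (X - C (θ j)) := by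
    have hdeg : ∀ u : Fin d → ℝ, (∏ i : Fin d, (X - C (u i)) : ℝ[X]).degree = d := fun u => by
      rw [degree_prod]
      simp only [degree_X_sub_C, Finset.sum_const, Finset.card_univ, Fintype.card_fin,
        nsmul_eq_mul, mul_one]
    have hlt : (1 : ℝ[X]).degree < (∏ i : Fin d, (X - C ((n : ℝ) * (i : ℕ)))).degree := by
      rw [degree_one, hdeg]
      exact_mod_cast hd
    refine eq_of_degree_le_of_eval_index_eq Finset.univ (v := θ)
      (h.strictMono hn).injective.injOn ?_ ?_ ?_ ?_
    · rw [degree_sub_eq_left_of_degree_lt hlt, hdeg]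
      simp
    · rw [degree_sub_eq_left_of_degree_lt hlt, hdeg, hdeg]
    · rw [leadingCoeff_sub_of_degree_lt hlt, leadingCoeff_prod, leadingCoeff_prod]
      simp only [leadingCoeff_X_sub_C]
    · intro j _
      simp only [eval_sub, eval_prod, eval_X, eval_C, eval_one]
      rw [h.prod_sub j, sub_self,
        Finset.prod_eq_zero (i := j) (Finset.mem_univ j) (sub_self _)]
  have := congrArg (eval ((n : ℝ) * (i : ℕ))) key
  simp only [eval_sub, eval_prod, eval_X, eval_C, eval_one] at this
  rw [Finset.prod_eq_zero (i := i) (Finset.mem_univ i) (sub_self _), zero_sub] at this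
  rw [← Finset.abs_prod]
  have h2 := congrArg abs this
  rw [abs_neg, abs_one, Finset.abs_prod] at h2
  rw [Finset.abs_prod, h2]
  exact Finset.prod_congr rfl fun j _ => abs_sub_comm _ _

end IsCasselsRoots

/-- A `d × d` array with vanishing row and column sums, off-diagonal entries nonnegative and within
`K` of `L`. -/
structure IsUnitArray {d : ℕ} (ℓ : Fin d → Fin d → ℝ) (L K : ℝ) : Prop where
  off_nonneg : ∀ i j, i ≠ j → 0 ≤ ℓ i j
  off_close : ∀ i j, i ≠ j → |ℓ i j - L| ≤ K
  sum_left : ∀ j, ∑ i, ℓ i j = 0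
  sum_right : ∀ i, ∑ j, ℓ i j = 0

namespace IsUnitArray

variable {d : ℕ} {ℓ : Fin d → Fin d → ℝ} {L K : ℝ}

theorem diag_eq (h : IsUnitArray ℓ L K) (j : Fin d) :
    ℓ j j = - ∑ i ∈ Finset.univ.erase j, ℓ i j := by
  have := h.sum_left j
  rw [← Finset.add_sum_erase _ _ (Finset.mem_univ j)] at this
  linarith

theorem abs_sub_le (h : IsUnitArray ℓ L K) (hK : 0 ≤ K) (i j : Fin d) :
    |ℓ i j - L * (1 - if i = j then (d : ℝ) else 0)| ≤ d * K := by
  have hd : (1 : ℝ) ≤ d := by exact_mod_cast i.pos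
  split_ifs with hij
  · subst hij
    have hcard : ((Finset.univ.erase i).card : ℝ) = d - 1 := by
      rw [Finset.card_erase_of_mem (Finset.mem_univ i), Finset.card_univ, Fintype.card_fin,
        Nat.cast_sub i.pos, Nat.cast_one]
    have h1 : ℓ i i - L * (1 - d) = - ∑ k ∈ Finset.univ.erase i, (ℓ k i - L) := by
      rw [h.diag_eq, Finset.sum_sub_distrib, Finset.sum_const, nsmul_eq_mul, hcard]
      ring
    rw [h1, abs_neg]
    refine (Finset.abs_sum_le_sum_abs _ _).trans ?_
    refine (Finset.sum_le_card_nsmul _ _ K fun k hk =>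
      h.off_close k i (Finset.mem_erase.1 hk).1).trans ?_
    rw [nsmul_eq_mul, hcard]
    nlinarith
  · rw [sub_zero, mul_one]
    exact (h.off_close i j hij).trans (le_mul_of_one_le_left hK hd)

theorem sum_mul_sub_le (h : IsUnitArray ℓ L K) (hK : 0 ≤ K) (hL : 0 ≤ L) {w : Fin d → ℝ}
    (hw0 : ∀ i, 0 ≤ w i) (hw2 : ∀ i, w i ≤ 2) {j j' : Fin d} (hjj : w j' ≤ w j) :
    ∑ i, w i * ℓ i j ≤ ∑ i, w i * ℓ i j' + 4 * (d : ℝ) ^ 2 * K := by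
  set r : Fin d → Fin d → ℝ := fun i j => ℓ i j - L * (1 - if i = j then (d : ℝ) else 0) with hr
  have hsum : ∀ j, ∑ i, w i * ℓ i j = L * ∑ i, w i - L * d * w j + ∑ i, w i * r i j := by
    intro j
    have h1 : ∀ i, w i * ℓ i j =
        L * w i - L * d * (if i = j then w i else 0) + w i * r i j := by
      intro i
      simp only [hr]
      split_ifs <;> ring
    simp only [h1, Finset.sum_add_distrib, Finset.sum_sub_distrib, ← Finset.mul_sum,
      Finset.sum_ite_eq', Finset.mem_univ, if_true]
  have hrs : ∀ j, |∑ i, w i * r i j| ≤ 2 * (d : ℝ) ^ 2 * K := by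
    intro j
    refine (Finset.abs_sum_le_sum_abs _ _).trans ?_
    refine (Finset.sum_le_card_nsmul _ _ (2 * (d * K)) fun i _ => ?_).trans ?_
    · rw [abs_mul, abs_of_nonneg (hw0 i)]
      exact mul_le_mul (hw2 i) (h.abs_sub_le hK i j) (abs_nonneg _) zero_le_two
    · rw [nsmul_eq_mul, Finset.card_univ, Fintype.card_fin]
      exact le_of_eq (by ring)
  rw [hsum, hsum]
  have h1 := (abs_le.1 (hrs j)).2
  have h2 := (abs_le.1 (hrs j')).1
  have h3 : L * d * w j' ≤ L * d * w j := mul_le_mul_of_nonneg_left hjj (by positivity)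
  linarith

theorem sum_prefix_sub_le (h : IsUnitArray ℓ L K) (p : Equiv.Perm (Fin d)) {j j' : Fin d}
    (hj : j ≠ j') :
    ∑ i with p i < p j', ℓ i j ≤ ∑ i with p i < p j, ℓ i j - (L - K) := by
  have hle : L - K ≤ ℓ j' j := by linarith [(abs_le.1 (h.off_close j' j hj.symm)).1]
  rcases lt_or_gt_of_ne (p.injective.ne hj) with hlt | hlt
  · have hsub : (Finset.univ.filter fun i => p i < p j') =
        Finset.univ \ (Finset.univ.filter fun i => ¬ p i < p j') := by
      ext i; simp
    have h1 : ∑ i with p i < p j', ℓ i j = - ∑ i with ¬ p i < p j', ℓ i j := by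
      have := Finset.sum_filter_add_sum_filter_not Finset.univ (fun i => p i < p j')
        (fun i => ℓ i j)
      rw [h.sum_left] at this
      linarith
    have h2 : ℓ j' j ≤ ∑ i with ¬ p i < p j', ℓ i j :=
      Finset.single_le_sum (f := fun i => ℓ i j)
        (fun i hi => h.off_nonneg i j fun e => by
          subst e; exact (Finset.mem_filter.1 hi).2 hlt)
        (Finset.mem_filter.2 ⟨Finset.mem_univ _, lt_irrefl _⟩)
    have h3 : 0 ≤ ∑ i with p i < p j, ℓ i j := Finset.sum_nonneg fun i hi =>
      h.off_nonneg i j fun e => by subst e; exact lt_irrefl _ (Finset.mem_filter.1 hi).2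
    linarith
  · have h1 : ∑ i ∈ insert j' (Finset.univ.filter fun i => p i < p j'), ℓ i j ≤
        ∑ i with p i < p j, ℓ i j := by
      refine Finset.sum_le_sum_of_subset_of_nonneg ?_ fun i hi _ => h.off_nonneg i j fun e => by
        subst e; exact lt_irrefl _ (Finset.mem_filter.1 hi).2
      intro i hi
      rcases Finset.mem_insert.1 hi with rfl | hi
      · simpa using hlt
      · simpa using (Finset.mem_filter.1 hi).2.trans hlt
    rw [Finset.sum_insert (by simp)] at h1
    linarith

theorem sum_sum_prefix_le (h : IsUnitArray ℓ L K) (p : Equiv.Perm (Fin d)) :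
    ∑ j, ∑ i with p i < p j, ℓ i j ≤ (∑ j : Fin d, (j : ℕ) : ℕ) * (L + K) := by
  have h1 : ∀ j, ∑ i with p i < p j, ℓ i j ≤ ((p j : ℕ) : ℝ) * (L + K) := by
    intro j
    have hcard : (Finset.univ.filter fun i => p i < p j).card = (p j : ℕ) := by
      rw [← Fin.card_Iio, ← Finset.card_map p.toEmbedding]
      congr 1
      ext i
      simp [Finset.mem_map_equiv]
    refine (Finset.sum_le_card_nsmul _ _ (L + K) fun i hi => ?_).trans ?_
    · have hij : i ≠ j := fun e => by subst e; exact lt_irrefl _ (Finset.mem_filter.1 hi).2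
      linarith [(abs_le.1 (h.off_close i j hij)).2]
    · rw [nsmul_eq_mul, hcard]
  refine (Finset.sum_le_sum fun j _ => h1 j).trans ?_
  rw [← Finset.sum_mul, Equiv.sum_comp p (fun j : Fin d => ((j : ℕ) : ℝ)), Nat.cast_sum]

/-- The rows of the array span the hyperplane of vectors with vanishing sum. -/
theorem exists_nonneg_sum_eq (h : IsUnitArray ℓ L K) (hpos : ∀ i j, i ≠ j → 0 < ℓ i j)
    {t : Fin d → ℝ} (ht : ∑ j, t j = 0) :
    ∃ c : Fin d → ℝ, (∀ i, 0 ≤ c i) ∧ ∀ j, t j = ∑ i, c i * ℓ i j := by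
  rcases Nat.eq_zero_or_pos d with rfl | hd
  · exact ⟨0, fun i => i.elim0, fun j => j.elim0⟩
  have : Nonempty (Fin d) := ⟨⟨0, hd⟩⟩
  have hd' : (d : ℝ) ≠ 0 := by exact_mod_cast hd.ne'
  let f : (Fin d → ℝ) →ₗ[ℝ] (Fin d → ℝ) := (Matrix.of fun j i => ℓ i j + 1).mulVecLin
  have hf : ∀ c j, f c j = ∑ i, c i * ℓ i j + ∑ i, c i := by
    intro c j
    simp only [f, Matrix.mulVecLin_apply, Matrix.mulVec, dotProduct, Matrix.of_apply,
      ← Finset.sum_add_distrib]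
    exact Finset.sum_congr rfl fun i _ => by ring
  have hfs : ∀ c, ∑ j, f c j = d * ∑ i, c i := by
    intro c
    simp only [hf, Finset.sum_add_distrib]
    rw [Finset.sum_comm]
    simp [← Finset.mul_sum, h.sum_right]
  have hinj : Function.Injective f := by
    rw [injective_iff_map_eq_zero]
    intro c hc
    have hs : ∑ i, c i = 0 := by
      have := hfs c
      simpa [hc, hd'] using this.symm
    obtain ⟨j, hj⟩ := Finite.exists_max c
    have h0 : ∑ i, (c j - c i) * ℓ i j = 0 := by
      have h1 := hf c j
      rw [hc, hs, add_zero] at h1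
      simp only [sub_mul, Finset.sum_sub_distrib, ← Finset.mul_sum, h.sum_left, ← h1]
      simp
    have hconst : ∀ i, c i = c j := by
      intro i
      by_cases hij : i = j
      · rw [hij]
      have := (Finset.sum_eq_zero_iff_of_nonneg fun i _ => by
        by_cases hij : i = j
        · simp [hij]
        · exact mul_nonneg (sub_nonneg.2 (hj i)) (h.off_nonneg i j hij)).1 h0 i
            (Finset.mem_univ i)
      have := (mul_eq_zero.1 this).resolve_right (hpos i j hij).ne'
      linarith
    have hcj : c j = 0 := by
      rw [Finset.sum_congr rfl fun i _ => hconst i] at hs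
      simpa [hd'] using hs
    ext i
    rw [hconst, hcj, Pi.zero_apply]
  obtain ⟨c, hc⟩ := LinearMap.injective_iff_surjective.1 hinj t
  have hs : ∑ i, c i = 0 := by
    have := hfs c
    rw [hc, ht] at this
    simpa [hd'] using this.symm
  obtain ⟨m, hm⟩ := Finite.exists_min c
  refine ⟨fun i => c i - c m, fun i => sub_nonneg.2 (hm i), fun j => ?_⟩
  simp only [sub_mul, Finset.sum_sub_distrib, ← Finset.mul_sum, h.sum_left]
  rw [← hc, hf, hs]
  ring

end IsUnitArray

/-- `g` is the lattice `ℤ[θ]` embedded in `ℝ^d` and rescaled by `c` to have covolume one. -/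
structure IsCasselsLattice (d n : ℕ) (θ : Fin d → ℝ) (c : ℝ) (g : SLR d) : Prop
    extends IsCasselsRoots d n θ where
  scale_pos : 0 < c
  coe_apply : ∀ j m, (g : Matrix (Fin d) (Fin d) ℝ) j m = c * θ j ^ (m : ℕ)

theorem exists_isCasselsLattice {d n : ℕ} (hd : 0 < d) (hn : 4 ≤ n) :
    ∃ θ c g, IsCasselsLattice d n θ c g := by
  obtain ⟨θ, hθ⟩ := exists_isCasselsRoots d (show 2 ≤ n by omega)
  have hpos : 0 < (Matrix.vandermonde θ).det := by
    rw [Matrix.det_vandermonde]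
    exact Finset.prod_pos fun i _ => Finset.prod_pos fun j hj =>
      sub_pos.2 (hθ.strictMono hn (Finset.mem_Ioi.1 hj))
  set c : ℝ := ((Matrix.vandermonde θ).det ^ (d : ℝ)⁻¹)⁻¹ with hc
  have hcpos : 0 < c := by positivity
  refine ⟨θ, c, ⟨c • Matrix.vandermonde θ, ?_⟩, { hθ with
    scale_pos := hcpos
    coe_apply := fun j m => rfl }⟩
  rw [Matrix.det_smul, Fintype.card_fin, hc, inv_pow, Real.rpow_inv_natCast_pow hpos.le hd.ne',
    inv_mul_cancel₀ hpos.ne']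

theorem IsCasselsRoots.isUnitArray {d n : ℕ} {θ : Fin d → ℝ} (h : IsCasselsRoots d n θ)
    (hn : 4 ≤ n) :
    IsUnitArray (fun i j => Real.log |θ j - n * (i : ℕ)|) (Real.log n) (Real.log (2 * d)) where
  off_nonneg i j hij := by
    have hn' : (4 : ℝ) ≤ n := by exact_mod_cast hn
    exact Real.log_nonneg (by linarith [h.half_le_abs_sub hn hij])
  off_close i j hij := by
    have hn' : (4 : ℝ) ≤ n := by exact_mod_cast hn
    have hd : (1 : ℝ) ≤ d := by exact_mod_cast i.pos
    have h1 := h.half_le_abs_sub hn hij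
    have h2 := h.abs_sub_le_mul hn i j
    rw [abs_le]
    constructor
    · rw [neg_le_sub_iff_le_add, ← Real.log_mul (by linarith) (by linarith)]
      refine Real.log_le_log (by linarith) ?_
      nlinarith
    · rw [sub_le_iff_le_add, ← Real.log_mul (by linarith) (by linarith)]
      refine Real.log_le_log (by linarith) ?_
      nlinarith
  sum_left j := by
    rw [← Real.log_prod fun i _ => abs_ne_zero.2 (h.sub_ne_zero i j), ← Finset.abs_prod,
      h.prod_sub, abs_one, Real.log_one]
  sum_right i := by
    rw [← Real.log_prod fun j _ => abs_ne_zero.2 (h.sub_ne_zero i j), h.prod_abs_sub hn,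
      Real.log_one]

theorem IsCasselsRoots.exists_nonneg_sum_log_eq {d n : ℕ} {θ : Fin d → ℝ}
    (h : IsCasselsRoots d n θ) (hn : 4 ≤ n) {t : Fin d → ℝ} (ht : ∑ j, t j = 0) :
    ∃ a : Fin d → ℝ, (∀ i, 0 ≤ a i) ∧ ∀ j, t j = -∑ i, a i * Real.log |θ j - n * (i : ℕ)| := by
  have hn' : (4 : ℝ) ≤ n := by exact_mod_cast hn
  obtain ⟨a, ha, hta⟩ := (h.isUnitArray hn).exists_nonneg_sum_eq
    (fun i j hij => Real.log_pos (by linarith [h.half_le_abs_sub hn hij]))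
    (t := fun j => -t j) (by rw [Finset.sum_neg_distrib, ht, neg_zero])
  exact ⟨a, ha, fun j => by rw [← hta, neg_neg]⟩

namespace IsCasselsLattice

variable {d n : ℕ} {θ : Fin d → ℝ} {c : ℝ} {g : SLR d}

open Polynomial in
theorem exists_intMatrix (h : IsCasselsLattice d n θ c g) (t : Fin d → ℝ) (ht : ∑ i, t i = 0)
    (P : Fin d → ℤ[X]) :
    ∃ T : Matrix (Fin d) (Fin d) ℤ, ∀ j m,
      (((aSL d t ht * g : SLR d) : Matrix (Fin d) (Fin d) ℝ) * T.map (Int.cast : ℤ → ℝ)) j m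
        = Real.exp (t j) * c * aeval (θ j) (P m) := by
  choose w hw using fun m : Fin d => h.exists_aeval_eq_sum m.pos (P m)
  refine ⟨Matrix.of fun l m => w m l, fun j m => ?_⟩
  rw [Matrix.mul_apply, hw, Finset.mul_sum]
  refine Finset.sum_congr rfl fun l _ => ?_
  rw [coe_aSL_mul, h.coe_apply, Matrix.map_apply, Matrix.of_apply]
  ring

theorem exp_sum_mul_log (h : IsCasselsRoots d n θ) (k : Fin d → ℕ) (j : Fin d) :
    Real.exp (∑ i, (k i : ℝ) * Real.log |θ j - n * (i : ℕ)|) =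
      |∏ i : Fin d, (θ j - n * (i : ℕ)) ^ k i| := by
  rw [Real.exp_sum, Finset.abs_prod]
  refine Finset.prod_congr rfl fun i _ => ?_
  rw [Real.exp_nat_mul, Real.exp_log (abs_pos.2 (h.sub_ne_zero i j)), abs_pow]

theorem mk_aSL_add (h : IsCasselsLattice d n θ c g) (t : Fin d → ℝ) (ht : ∑ i, t i = 0)
    (k : Fin d → ℕ) (t' : Fin d → ℝ) (ht' : ∑ i, t' i = 0)
    (htt : ∀ j, t' j = t j + ∑ i, ((2 * k i : ℕ) : ℝ) * Real.log |θ j - n * (i : ℕ)|) :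
    (QuotientGroup.mk (aSL d t ht * g) : XSpace d) = QuotientGroup.mk (aSL d t' ht' * g) := by
  obtain ⟨T, hT⟩ := h.exists_intMatrix t ht fun m =>
    (∏ i : Fin d, (Polynomial.X - Polynomial.C ((n : ℤ) * (i : ℕ))) ^ (2 * k i)) *
      Polynomial.X ^ (m : ℕ)
  refine mk_eq_mk_of_mul_map T ?_
  ext j m
  rw [hT, coe_aSL_mul, h.coe_apply, htt, Real.exp_add, exp_sum_mul_log h.toIsCasselsRoots,
    abs_of_nonneg (Finset.prod_nonneg fun i _ => (even_two_mul _).pow_nonneg _)]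
  simp only [map_mul, map_prod, map_pow, map_sub, Polynomial.aeval_X, Polynomial.aeval_C]
  simp only [algebraMap_int_eq, eq_intCast, Int.cast_natCast]
  ring

theorem isCompact_Aorbit (h : IsCasselsLattice d n θ c g) (hn : 4 ≤ n) :
    IsCompact (Aorbit d (QuotientGroup.mk g)) := by
  set s : (Fin d → ℝ) → Fin d → ℝ := fun b j =>
    ∑ i, b i * Real.log |θ j - n * (i : ℕ)| with hs
  have hs0 : ∀ b, ∑ j, s b j = 0 := by
    intro b
    simp only [hs]
    rw [Finset.sum_comm]
    exact Finset.sum_eq_zero fun i _ => by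
      rw [← Finset.mul_sum, (h.isUnitArray hn).sum_right i, mul_zero]
  have hcont : Continuous fun b => (QuotientGroup.mk (aSL d (s b) (hs0 b) * g) : XSpace d) := by
    refine QuotientGroup.continuous_mk.comp (Continuous.mul ?_ continuous_const)
    refine continuous_induced_rng.2 (Continuous.matrix_diagonal ?_)
    fun_prop
  have himg : Aorbit d (QuotientGroup.mk g) =
      (fun b => (QuotientGroup.mk (aSL d (s b) (hs0 b) * g) : XSpace d)) ''
        Set.Icc (fun _ => 0) (fun _ => 2) := by
    ext y
    constructor
    · rintro ⟨t, ht, rfl⟩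
      obtain ⟨a, ha, hta⟩ := h.exists_nonneg_sum_log_eq hn ht
      refine ⟨fun i => ((2 * ⌈a i / 2⌉₊ : ℕ) : ℝ) - a i, ⟨fun i => ?_, fun i => ?_⟩, ?_⟩
      · have := Nat.le_ceil (a i / 2)
        push_cast
        linarith
      · have := Nat.ceil_lt_add_one (div_nonneg (ha i) zero_le_two)
        push_cast
        linarith
      · rw [aSL_smul_mk]
        refine (h.mk_aSL_add t ht (fun i => ⌈a i / 2⌉₊) _ _ fun j => ?_).symm
        simp only [hs, hta, sub_mul, Finset.sum_sub_distrib]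
        ring
    · rintro ⟨b, -, rfl⟩
      exact ⟨s b, hs0 b, rfl⟩
  rw [himg]
  exact isCompact_Icc.image hcont

end IsCasselsLattice

open Polynomial in
theorem abs_det_prefix_eq {d : ℕ} (n : ℕ) (θ : Fin d → ℝ) (p : Equiv.Perm (Fin d)) :
    |(Matrix.of fun j j' => ∏ i with p i < p j', (θ j - n * (i : ℕ))).det| =
      |(Matrix.vandermonde θ).det| := by
  set Q : Fin d → ℝ[X] := fun m => ∏ i with p i < m, (X - C ((n : ℝ) * (i : ℕ))) with hQ
  have hcard : ∀ m : Fin d, (Finset.univ.filter fun i => p i < m).card = (m : ℕ) := by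
    intro m
    rw [← Fin.card_Iio, ← Finset.card_map p.toEmbedding]
    congr 1
    ext i
    simp [Finset.mem_map_equiv]
  have hmon : ∀ m, (Q m).Monic := fun m => monic_prod_of_monic _ _ fun i _ => monic_X_sub_C _
  have hdeg : ∀ m, (Q m).natDegree = m := by
    intro m
    rw [hQ, natDegree_prod_of_monic _ _ fun i _ => monic_X_sub_C _]
    simp only [natDegree_X_sub_C, Finset.sum_const, smul_eq_mul, mul_one, hcard]
  rw [Matrix.det_eval_matrixOfPolynomials_eq_det_vandermonde θ Q hdeg hmon]
  have : (Matrix.of fun j j' => ∏ i with p i < p j', (θ j - n * (i : ℕ))) =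
      (Matrix.of fun i j => (Q j).eval (θ i)).submatrix id p := by
    ext j j'
    simp [hQ, eval_prod]
  rw [this, Matrix.det_permute', abs_mul]
  rcases Int.units_eq_one_or (Equiv.Perm.sign p) with hs | hs <;> simp [hs]

namespace IsCasselsLattice

variable {d n : ℕ} {θ : Fin d → ℝ} {c : ℝ} {g : SLR d}

theorem scale_pow_mul_det (h : IsCasselsLattice d n θ c g) :
    c ^ d * (Matrix.vandermonde θ).det = 1 := by
  have : (g : Matrix (Fin d) (Fin d) ℝ) = c • Matrix.vandermonde θ := by
    ext j m
    rw [h.coe_apply]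
    rfl
  rw [← g.2, this, Matrix.det_smul, Fintype.card_fin]

theorem mul_log_scale_le (h : IsCasselsLattice d n θ c g) (hn : 4 ≤ n) :
    d * Real.log c ≤
      -((∑ j : Fin d, (j : ℕ) : ℕ) * (Real.log n - Real.log (2 * d))) := by
  have hn' : (4 : ℝ) ≤ n := by exact_mod_cast hn
  have hpos : ∀ i, ∀ j ∈ Finset.Ioi i, 0 < θ j - θ i := fun i j hj =>
    sub_pos.2 (h.strictMono hn (Finset.mem_Ioi.1 hj))
  have h1 := congrArg Real.log h.scale_pow_mul_det
  rw [Matrix.det_vandermonde, Real.log_one, Real.log_mul (pow_ne_zero _ h.scale_pos.ne')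
    (Finset.prod_pos fun i _ => Finset.prod_pos (hpos i)).ne', Real.log_pow,
    Real.log_prod fun i _ => (Finset.prod_pos (hpos i)).ne'] at h1
  have h2 : ∀ i : Fin d, (((Fin.rev i : Fin d) : ℕ) : ℝ) * (Real.log n - Real.log (2 * d)) ≤
      Real.log (∏ j ∈ Finset.Ioi i, (θ j - θ i)) := by
    intro i
    have hd : (1 : ℝ) ≤ d := by exact_mod_cast i.pos
    rw [Real.log_prod fun j hj => (hpos i j hj).ne']
    have hcard : (((Fin.rev i : Fin d) : ℕ) : ℝ) = (Finset.Ioi i).card := by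
      rw [Fin.card_Ioi, Fin.val_rev, Nat.sub_sub, add_comm]
    rw [hcard, ← nsmul_eq_mul]
    refine Finset.card_nsmul_le_sum _ _ _ fun j hj => ?_
    have hlt := hpos i j hj
    rw [sub_le_iff_le_add, ← Real.log_mul hlt.ne' (by linarith)]
    refine Real.log_le_log (by linarith) ?_
    nlinarith [h.half_le_sub hn (Finset.mem_Ioi.1 hj)]
  have h3 := Finset.sum_le_sum fun i (_ : i ∈ Finset.univ) => h2 i
  have hrev := Equiv.sum_comp Fin.revPerm fun i : Fin d => ((i : ℕ) : ℝ)
  simp only [Fin.revPerm_apply] at hrev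
  rw [← Finset.sum_mul, hrev, ← Nat.cast_sum] at h3
  linarith

open Polynomial in
/-- A translate of a Cassels lattice under the diagonal group has, if it has no vector shorter than
`ε`, a basis which is nearly diagonal. -/
theorem exists_near_diagonal_basis (h : IsCasselsLattice d n θ c g) (hn : 4 ≤ n)
    (t : Fin d → ℝ) (ht : ∑ i, t i = 0) {ε : ℝ} (hε : 0 < ε)
    (hsys : ∀ v : Fin d → ℤ, v ≠ 0 → ∃ i, ε ≤
      |((aSL d t ht * g : SLR d) : Matrix (Fin d) (Fin d) ℝ).mulVec (fun i => (v i : ℝ)) i|)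
    {a b : ℝ} (ha : a = Real.log ε - 4 * (d : ℝ) ^ 2 * Real.log (2 * d))
    (hb : b = 2 * (∑ j : Fin d, (j : ℕ) : ℕ) * Real.log (2 * d) - (d - 1) * a) :
    ∃ T : Matrix (Fin d) (Fin d) ℤ, ∃ G : Matrix (Fin d) (Fin d) ℝ,
      G = ((aSL d t ht * g : SLR d) : Matrix (Fin d) (Fin d) ℝ) * T.map (Int.cast : ℤ → ℝ) ∧
      |G.det| = 1 ∧ (∀ j, Real.exp a ≤ G j j ∧ G j j ≤ Real.exp b) ∧
      ∀ j j', j ≠ j' → |G j j'| ≤ Real.exp b * (2 * d / n) := by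
  rcases Nat.eq_zero_or_pos d with rfl | hd
  · exact ⟨1, _, rfl, by simp, fun j => j.elim0, fun j => j.elim0⟩
  have hd1 : (1 : ℝ) ≤ d := by exact_mod_cast hd
  have hn' : (4 : ℝ) ≤ n := by exact_mod_cast hn
  set ℓ : Fin d → Fin d → ℝ := fun i j => Real.log |θ j - n * (i : ℕ)| with hℓ
  set L := Real.log n with hL
  set K := Real.log (2 * d) with hK
  have hL0 : 0 ≤ L := Real.log_nonneg (by linarith)
  have hK0 : 0 ≤ K := Real.log_nonneg (by linarith)
  have hA : IsUnitArray ℓ L K := h.isUnitArray hn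
  obtain ⟨α, hα, hta⟩ := h.exists_nonneg_sum_log_eq hn ht
  set k : Fin d → ℕ := fun i => ⌈α i⌉₊ with hk
  set e : Fin d → ℝ := fun i => k i - α i with he
  have he0 : ∀ i, 0 ≤ e i := fun i => sub_nonneg.2 (Nat.le_ceil _)
  have he1 : ∀ i, e i ≤ 1 := fun i => by
    have := Nat.ceil_lt_add_one (hα i)
    simp only [he, hk]
    linarith
  set p : Equiv.Perm (Fin d) := (Tuple.sort e).symm with hp
  have hsort : ∀ i j, p i ≤ p j → e i ≤ e j := fun i j hij => by
    have := Tuple.monotone_sort e hij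
    simpa [hp] using this
  set w : Fin d → Fin d → ℝ := fun j' i => e i + if p i < p j' then 1 else 0 with hw
  set E : Fin d → Fin d → ℝ := fun j j' => Real.log c + ∑ i, w j' i * ℓ i j with hE
  have hE' : ∀ j j', E j j' =
      Real.log c + ∑ i, e i * ℓ i j + ∑ i with p i < p j', ℓ i j := by
    intro j j'
    simp only [hE, hw, add_mul, Finset.sum_add_distrib, ite_mul, one_mul, zero_mul,
      Finset.sum_filter, add_assoc]
  set P : Fin d → ℤ[X] := fun j' => (∏ i : Fin d, (X - C ((n : ℤ) * (i : ℕ))) ^ k i) *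
    ∏ i with p i < p j', (X - C ((n : ℤ) * (i : ℕ))) with hP
  set u : Fin d → ℝ := fun j => ∏ i : Fin d, (θ j - n * (i : ℕ)) ^ k i with hu
  set W : Matrix (Fin d) (Fin d) ℝ :=
    Matrix.of fun j j' => ∏ i with p i < p j', (θ j - n * (i : ℕ)) with hW
  set H : Fin d → Fin d → ℝ := fun j j' => Real.exp (t j) * c * (u j * W j j') with hH
  have hPe : ∀ j j', aeval (θ j) (P j') = u j * W j j' := by
    intro j j'
    simp only [hP, hu, hW, map_mul, map_prod, map_pow, map_sub, aeval_X,
      map_natCast, Matrix.of_apply]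
  have hue : ∀ j, |u j| = Real.exp (∑ i, (k i : ℝ) * ℓ i j) := fun j =>
    (exp_sum_mul_log h.toIsCasselsRoots k j).symm
  have htu : ∀ j, Real.exp (t j) * |u j| = Real.exp (∑ i, e i * ℓ i j) := by
    intro j
    rw [hue, ← Real.exp_add, hta]
    congr 1
    simp only [he, sub_mul, Finset.sum_sub_distrib]
    ring
  have hHE : ∀ j j', |H j j'| = Real.exp (E j j') := by
    intro j j'
    rw [hE', Real.exp_add, Real.exp_add, Real.exp_log h.scale_pos, ← htu, Real.exp_sum,
      hH]
    simp only [abs_mul, Real.abs_exp, abs_of_pos h.scale_pos]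
    have : |W j j'| = ∏ i with p i < p j', Real.exp (ℓ i j) := by
      rw [hW, Matrix.of_apply, Finset.abs_prod]
      exact Finset.prod_congr rfl fun i _ =>
        (Real.exp_log (abs_pos.2 (h.sub_ne_zero i j))).symm
    rw [this]
    ring
  have hH0 : ∀ j j', H j j' ≠ 0 := fun j j' => by
    rw [← abs_pos, hHE]
    exact Real.exp_pos _
  set s : Fin d → ℤ := fun j => if 0 < H j j then 1 else -1 with hs
  have hs1 : ∀ j, |(s j : ℝ)| = 1 := fun j => by
    simp only [hs]
    split_ifs <;> simp
  have hsH : ∀ j, H j j * s j = |H j j| := fun j => by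
    simp only [hs]
    split_ifs with hpos
    · rw [abs_of_pos hpos]
      simp
    · rw [abs_of_nonpos (not_lt.1 hpos)]
      simp
  obtain ⟨T, hT⟩ := h.exists_intMatrix t ht fun j' => C (s j') * P j'
  set G : Matrix (Fin d) (Fin d) ℝ :=
    ((aSL d t ht * g : SLR d) : Matrix (Fin d) (Fin d) ℝ) * T.map (Int.cast : ℤ → ℝ) with hG
  have hGH : ∀ j j', G j j' = H j j' * s j' := by
    intro j j'
    rw [hT, map_mul, hPe, aeval_C, hH]
    simp only [algebraMap_int_eq, eq_intCast]
    ring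
  have hGabs : ∀ j j', |G j j'| = Real.exp (E j j') := fun j j' => by
    rw [hGH, abs_mul, hs1, mul_one, hHE]
  have hGdiag : ∀ j, G j j = Real.exp (E j j) := fun j => by rw [hGH, hsH, hHE]
  have hdet : |G.det| = 1 := by
    have hGm : G = Matrix.diagonal (fun j => Real.exp (t j) * c * u j) * W *
        Matrix.diagonal (fun j => (s j : ℝ)) := by
      ext j j'
      rw [Matrix.mul_diagonal, Matrix.diagonal_mul, hGH, hH]
      ring
    have hu1 : ∏ j, |u j| = 1 := by
      simp only [hue]
      rw [← Real.exp_sum, Finset.sum_comm]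
      simp [← Finset.mul_sum, hA.sum_right]
    rw [hGm, Matrix.det_mul, Matrix.det_mul, Matrix.det_diagonal, Matrix.det_diagonal, abs_mul,
      abs_mul, abs_det_prefix_eq n θ p, Finset.abs_prod, Finset.abs_prod]
    simp only [hs1, abs_mul, Finset.prod_mul_distrib, Real.abs_exp, hu1, ← Real.exp_sum, ht,
      Finset.prod_const, Finset.card_univ, Fintype.card_fin]
    have := congrArg abs h.scale_pow_mul_det
    rw [abs_mul, abs_pow, abs_one] at this
    simpa using this
  have hcol : ∀ j j', E j j' ≤ E j' j' + 4 * (d : ℝ) ^ 2 * K := by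
    intro j j'
    have hw0 : ∀ i, 0 ≤ w j' i := fun i => by
      have := he0 i
      simp only [hw]
      split_ifs <;> linarith
    have hw2 : ∀ i, w j' i ≤ 2 := fun i => by
      have := he1 i
      simp only [hw]
      split_ifs <;> linarith
    have hww : w j' j' ≤ w j' j := by
      simp only [hw, lt_irrefl, if_false, add_zero]
      split_ifs with hlt
      · linarith [he1 j', he0 j]
      · linarith [hsort j' j (not_lt.1 hlt)]
    have := hA.sum_mul_sub_le hK0 hL0 hw0 hw2 hww
    simp only [hE]
    linarith
  have hlow : ∀ j, a ≤ E j j := by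
    intro j'
    have hTne : (fun l => T l j') ≠ 0 := by
      intro h0
      have h1 : G j' j' = 0 := by
        rw [hG, Matrix.mul_apply]
        refine Finset.sum_eq_zero fun l _ => ?_
        rw [Matrix.map_apply, show T l j' = 0 from congrFun h0 l, Int.cast_zero, mul_zero]
      rw [hGdiag] at h1
      exact (Real.exp_pos _).ne' h1
    obtain ⟨j, hj⟩ := hsys _ hTne
    have h1 : ε ≤ |G j j'| := hj
    rw [hGabs] at h1
    have h2 := (Real.log_le_iff_le_exp hε).2 h1
    linarith [hcol j j']
  have hsum : ∑ j, E j j ≤ 2 * (∑ j : Fin d, (j : ℕ) : ℕ) * K := by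
    have h1 := h.mul_log_scale_le hn
    have h2 := hA.sum_sum_prefix_le p
    simp only [hE', Finset.sum_add_distrib, Finset.sum_const, Finset.card_univ,
      Fintype.card_fin, nsmul_eq_mul]
    rw [Finset.sum_comm (f := fun j i => e i * ℓ i j)]
    simp only [← Finset.mul_sum, hA.sum_right, mul_zero, Finset.sum_const_zero]
    linarith
  have hup : ∀ j, E j j ≤ b := by
    intro j
    rw [← Finset.add_sum_erase _ _ (Finset.mem_univ j)] at hsum
    have h1 := Finset.card_nsmul_le_sum (Finset.univ.erase j) (fun j => E j j) a
      fun i _ => hlow i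
    rw [Finset.card_erase_of_mem (Finset.mem_univ j), Finset.card_univ, Fintype.card_fin,
      nsmul_eq_mul, Nat.cast_sub hd, Nat.cast_one] at h1
    linarith
  refine ⟨T, G, rfl, hdet, fun j => ?_, fun j j' hj => ?_⟩
  · rw [hGdiag]
    exact ⟨Real.exp_le_exp.2 (hlow j), Real.exp_le_exp.2 (hup j)⟩
  · have h1 := hA.sum_prefix_sub_le p hj
    have h2 : E j j' ≤ b + (K - L) := by
      have := hup j
      rw [hE'] at this ⊢
      linarith
    rw [hGabs]
    refine (Real.exp_le_exp.2 h2).trans (le_of_eq ?_)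
    rw [Real.exp_add, Real.exp_sub, Real.exp_log (by linarith), Real.exp_log (by linarith)]

end IsCasselsLattice

theorem diagonal_mem_Aorbit_stdLat {d : ℕ} (g : SLR d) (δ : Fin d → ℝ) (hδ : ∀ i, 0 < δ i)
    (hg : (g : Matrix (Fin d) (Fin d) ℝ) = Matrix.diagonal δ) :
    (QuotientGroup.mk g : XSpace d) ∈ Aorbit d (stdLat d) := by
  have hprod : ∏ i, δ i = 1 := by rw [← Matrix.det_diagonal, ← hg, g.2]
  have ht : ∑ i, Real.log (δ i) = 0 := by
    rw [← Real.log_prod fun i _ => (hδ i).ne', hprod, Real.log_one]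
  refine ⟨fun i => Real.log (δ i), ht, ?_⟩
  rw [stdLat, aSL_smul_mk, mul_one]
  congr 1
  refine Subtype.ext ?_
  rw [hg, aSL]
  simp only [Real.exp_log (hδ _)]

theorem mem_Aorbit_stdLat_of_tendsto {d : ℕ} {n : ℕ → ℕ} {θ : ℕ → Fin d → ℝ} {c : ℕ → ℝ}
    {g : ℕ → SLR d} (h : ∀ k, IsCasselsLattice d (n k) (θ k) (c k) (g k)) (hn : ∀ k, 4 ≤ n k)
    {U : Ultrafilter ℕ} (hU : Filter.Tendsto n U Filter.atTop)
    (t : ℕ → Fin d → ℝ) (ht : ∀ k, ∑ i, t k i = 0) {y : XSpace d}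
    (hy : Filter.Tendsto (fun k => aSL d (t k) (ht k) • (QuotientGroup.mk (g k) : XSpace d)) U
      (nhds y)) :
    y ∈ Aorbit d (stdLat d) := by
  obtain ⟨ε, hε, hev⟩ := eventually_nhds_le_abs_mulVec y
  set a : ℝ := Real.log ε - 4 * (d : ℝ) ^ 2 * Real.log (2 * d) with ha
  set b : ℝ := 2 * (∑ j : Fin d, (j : ℕ) : ℕ) * Real.log (2 * d) - (d - 1) * a with hb
  have key : ∀ᶠ k in (U : Filter ℕ), ∃ T : Matrix (Fin d) (Fin d) ℤ,
      ∃ G : Matrix (Fin d) (Fin d) ℝ,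
      G = ((aSL d (t k) (ht k) * g k : SLR d) : Matrix (Fin d) (Fin d) ℝ) *
        T.map (Int.cast : ℤ → ℝ) ∧
      |G.det| = 1 ∧ (∀ j, Real.exp a ≤ G j j ∧ G j j ≤ Real.exp b) ∧
      ∀ j j', j ≠ j' → |G j j'| ≤ Real.exp b * (2 * d / n k) := by
    filter_upwards [hy.eventually hev] with k hk
    exact (h k).exists_near_diagonal_basis (hn k) (t k) (ht k) hε (hk _ rfl) ha hb
  obtain ⟨T, hT⟩ := Filter.skolem.1 key
  obtain ⟨G, hG⟩ := Filter.skolem.1 hT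
  have hdiag : ∀ j, ∃ δ ∈ Set.Icc (Real.exp a) (Real.exp b),
      Filter.Tendsto (fun k => G k j j) U (nhds δ) := fun j =>
    isCompact_Icc.ultrafilter_le_nhds (U.map fun k => G k j j) <|
      Filter.tendsto_principal.2 (hG.mono fun k hk => hk.2.2.1 j)
  choose δ hδ hlim using hdiag
  have hδpos : ∀ j, 0 < δ j := fun j => (Real.exp_pos a).trans_le (hδ j).1
  have hoff : ∀ j j', j ≠ j' → Filter.Tendsto (fun k => G k j j') U (nhds 0) := by
    intro j j' hj
    have h0 : Filter.Tendsto (fun k => Real.exp b * (2 * d / (n k : ℝ))) U (nhds 0) := by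
      have := (tendsto_const_nhds (x := 2 * (d : ℝ))).div_atTop
        (tendsto_natCast_atTop_atTop.comp hU)
      simpa using this.const_mul (Real.exp b)
    exact squeeze_zero_norm' (hG.mono fun k hk => hk.2.2.2 j j' hj) h0
  have hGlim : Filter.Tendsto G U (nhds (Matrix.diagonal δ)) := by
    refine tendsto_pi_nhds.2 fun j => tendsto_pi_nhds.2 fun j' => ?_
    by_cases hj : j = j'
    · subst hj
      rw [Matrix.diagonal_apply_eq]
      exact hlim j
    · rw [Matrix.diagonal_apply_ne _ hj]
      exact hoff j j' hj
  have hdetlim : Filter.Tendsto (fun k => (G k).det) U (nhds (∏ j, δ j)) := by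
    rw [← Matrix.det_diagonal]
    exact ((continuous_id.matrix_det).tendsto _).comp hGlim
  have hdet1 : ∀ᶠ k in (U : Filter ℕ), (G k).det = 1 := by
    filter_upwards [hG, hdetlim.eventually_const_lt (Finset.prod_pos fun j _ => hδpos j)]
      with k hk hpos
    rw [← hk.2.1, abs_of_pos hpos]
  have hδdet : (Matrix.diagonal δ).det = 1 := by
    rw [Matrix.det_diagonal]
    exact tendsto_nhds_unique hdetlim (tendsto_const_nhds.congr' (hdet1.mono fun k hk => hk.symm))
  set Δ : SLR d := ⟨Matrix.diagonal δ, hδdet⟩ with hΔ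
  obtain ⟨g', hg'⟩ := Filter.skolem.1 (hdet1.mono fun k hk =>
    show ∃ g' : SLR d, (g' : Matrix (Fin d) (Fin d) ℝ) = G k from ⟨⟨G k, hk⟩, rfl⟩)
  have hg'lim : Filter.Tendsto g' U (nhds Δ) := by
    refine (Topology.IsInducing.subtypeVal
      (t := fun M : Matrix (Fin d) (Fin d) ℝ => M.det = 1)).tendsto_nhds_iff.2 ?_
    exact hGlim.congr' (hg'.mono fun k hk => hk.symm)
  have hmk : Filter.Tendsto (fun k => (QuotientGroup.mk (g' k) : XSpace d)) U
      (nhds (QuotientGroup.mk Δ)) :=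
    (QuotientGroup.continuous_mk.tendsto Δ).comp hg'lim
  have hyΔ : y = QuotientGroup.mk Δ := by
    refine tendsto_nhds_unique hy (hmk.congr' ?_)
    filter_upwards [hG, hg'] with k hk hk'
    rw [aSL_smul_mk]
    exact (mk_eq_mk_of_mul_map (T k) (hk'.trans hk.1)).symm
  rw [hyΔ]
  exact diagonal_mem_Aorbit_stdLat Δ δ hδpos rfl

theorem aSL_zero_smul {d : ℕ} (x : XSpace d) (h : ∑ _i : Fin d, (0 : ℝ) = 0) :
    aSL d (fun _ => 0) h • x = x := by
  have : aSL d (fun _ => 0) h = 1 := Subtype.ext (by simp [aSL])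
  rw [this, one_smul]

theorem mem_Aorbit_self {d : ℕ} (x : XSpace d) : x ∈ Aorbit d x :=
  ⟨fun _ => 0, by simp, (aSL_zero_smul x _).symm⟩

theorem Aorbit_eq_of_mem {d : ℕ} {x y : XSpace d} (h : y ∈ Aorbit d x) :
    Aorbit d y = Aorbit d x := by
  obtain ⟨t, ht, rfl⟩ := h
  have hmul : ∀ (s u : Fin d → ℝ) (hs : ∑ i, s i = 0) (hu : ∑ i, u i = 0)
      (hsu : ∑ i, (s i + u i) = 0),
      aSL d s hs • aSL d u hu • x = aSL d (fun i => s i + u i) hsu • x := by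
    intro s u hs hu hsu
    rw [smul_smul]
    congr 1
    refine Subtype.ext ?_
    rw [Matrix.SpecialLinearGroup.coe_mul]
    simp [aSL, Matrix.diagonal_mul_diagonal, Real.exp_add]
  ext z
  constructor
  · rintro ⟨s, hs, rfl⟩
    exact ⟨fun i => s i + t i, by rw [Finset.sum_add_distrib, hs, ht, add_zero], hmul _ _ _ _ _⟩
  · rintro ⟨s, hs, rfl⟩
    refine ⟨fun i => s i - t i, by rw [Finset.sum_sub_distrib, hs, ht, sub_zero], ?_⟩
    rw [hmul _ _ _ _ (by simpa using hs)]
    congr 2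
    simp

theorem stmt0 (d : ℕ) (hd : 2 ≤ d) :
    ∃ x : ℕ → XSpace d,
      (∀ k, IsCompact (Aorbit d (x k))) ∧
      (∀ k l, k ≠ l → Aorbit d (x k) ≠ Aorbit d (x l)) ∧
      (∀ (t : ℕ → Fin d → ℝ) (ht : ∀ k, ∑ i, t k i = 0) (y : XSpace d),
        MapClusterPt y Filter.atTop (fun k => aSL d (t k) (ht k) • x k) →
        y ∈ Aorbit d (stdLat d)) := by
  choose θ c g h using fun m : ℕ =>
    exists_isCasselsLattice (d := d) (n := m + 4) (by omega) (by omega)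
  set F : ℕ → Set (XSpace d) := fun m => Aorbit d (QuotientGroup.mk (g m)) with hF
  have hcomp : ∀ m, IsCompact (F m) := fun m => (h m).isCompact_Aorbit (by omega)
  have hclust : ∀ φ : ℕ → ℕ, Function.Injective φ → ∀ (t : ℕ → Fin d → ℝ)
      (ht : ∀ k, ∑ i, t k i = 0) (y : XSpace d), MapClusterPt y Filter.atTop
        (fun k => aSL d (t k) (ht k) • (QuotientGroup.mk (g (φ k)) : XSpace d)) →
      y ∈ Aorbit d (stdLat d) := by
    intro φ hφ t ht y hy
    obtain ⟨U, hU, hUy⟩ := mapClusterPt_iff_ultrafilter.1 hy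
    exact mem_Aorbit_stdLat_of_tendsto (fun k => h (φ k)) (fun k => by omega)
      ((Filter.tendsto_add_atTop_nat 4).comp (hφ.nat_tendsto_atTop.mono_left hU)) t ht hUy
  have hfin : (Set.range F).Infinite := by
    intro hfinite
    have : Finite (Set.range F) := hfinite
    obtain ⟨⟨O, m₀, rfl⟩, hO⟩ := Finite.exists_infinite_fiber (Set.rangeFactorization F)
    have hinf : {m | F m = F m₀}.Infinite :=
      (Set.infinite_coe_iff.1 hO).mono fun m hm => by
        simpa using congrArg Subtype.val hm
    set φ : ℕ → ℕ := fun k => hinf.natEmbedding _ k with hφ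
    have hφinj : Function.Injective φ :=
      Subtype.val_injective.comp (hinf.natEmbedding _).injective
    have hφF : ∀ k, F (φ k) = F m₀ := fun k => (hinf.natEmbedding _ k).2
    have hmem : ∀ k, (QuotientGroup.mk (g m₀) : XSpace d) ∈ F (φ k) := fun k => by
      rw [hφF]
      exact mem_Aorbit_self _
    choose t ht hgt using hmem
    have hst := hclust φ hφinj t ht (QuotientGroup.mk (g m₀)) <| by
      simp only [← hgt]
      exact tendsto_const_nhds.mapClusterPt
    apply not_isCompact_Aorbit_stdLat hd
    rw [← Aorbit_eq_of_mem hst]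
    exact hcomp m₀
  have hex : ∀ k, ∃ m, F m = (hfin.natEmbedding _ k : Set (XSpace d)) :=
    fun k => (hfin.natEmbedding _ k).2
  choose φ hφ using hex
  have hinj : Function.Injective fun k => F (φ k) := by
    intro k l hkl
    simp only [hφ] at hkl
    exact (hfin.natEmbedding _).injective (Subtype.ext hkl)
  exact ⟨fun k => QuotientGroup.mk (g (φ k)), fun k => hcomp _, fun k l hkl => hinj.ne hkl,
    hclust φ fun k l hkl => hinj (congrArg F hkl)⟩
end
end

section
/- Let d ≥ 2 and let m = (m_1,…,m_d) ∈ ℤ^d be a vector of pairwise distinct integers. For k ∈ ℕ let θ_k be a root of the polynomial p_k(x) = ∏_{i=1}^d (x − k m_i) − 1. Then for all sufficiently large k: p_k is irreducible over ℚ, ℚ(θ_k) is a totally real number field of degree d, each θ_k − k m_i (1 ≤ i ≤ d) is a unit of the order ℤ[θ_k], and the collection {θ_k − k m_i : 1 ≤ i ≤ d} generates the unit group ℤ[θ_k]^× up to roots of unity; that is, the subgroup of ℤ[θ_k]^× generated by −1 together with the elements θ_k − k m_i is all of ℤ[θ_k]^×. -/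
open Polynomial

noncomputable section

/-- The polynomial `p_k(x) = ∏_{i=1}^d (x - k m_i) - 1` over `ℤ`. -/
def pPoly (d : ℕ) (m : Fin d → ℤ) (k : ℕ) : Polynomial ℤ :=
  (∏ i : Fin d, (Polynomial.X - Polynomial.C ((k : ℤ) * m i))) - 1

section

variable {ι : Type*} [Fintype ι]

/-- The monic polynomial `∏ i, (x - a i) - 1` over `ℤ`. -/
def prodSubOne (a : ι → ℤ) : ℤ[X] := (∏ i, (X - C (a i))) - 1

theorem eval_prodSubOne (a : ι → ℤ) (i : ι) : (prodSubOne a).eval (a i) = -1 := by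
  simp [prodSubOne, eval_prod, Finset.prod_eq_zero (Finset.mem_univ i)]

theorem aeval_prodSubOne {A : Type*} [CommRing A] (a : ι → ℤ) (x : A) :
    aeval x (prodSubOne a) = ∏ i, (x - (a i : A)) - 1 := by
  simp [prodSubOne]

theorem monic_natDegree_prodSubOne [Nonempty ι] (a : ι → ℤ) :
    (prodSubOne a).Monic ∧ (prodSubOne a).natDegree = Fintype.card ι := by
  have hm : (∏ i, (X - C (a i))).Monic := monic_prod_X_sub_C a Finset.univ
  have hd : (∏ i, (X - C (a i))).natDegree = Fintype.card ι :=
    natDegree_finsetProd_X_sub_C_eq_card Finset.univ a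
  have hlt : (1 : ℤ[X]).degree < (∏ i, (X - C (a i))).degree := by
    rw [degree_one, degree_eq_natDegree hm.ne_zero, hd]
    exact_mod_cast Fintype.card_pos
  exact ⟨hm.sub_of_left hlt, (natDegree_sub_eq_left_of_natDegree_lt (by
    rw [natDegree_one, hd]; exact Fintype.card_pos)).trans hd⟩

/-- Schur: `∏ i, (x - a i) - 1` is irreducible for pairwise distinct integers `a i`. -/
theorem irreducible_prodSubOne [Nonempty ι] {a : ι → ℤ} (ha : Function.Injective a) :
    Irreducible (prodSubOne a) := by
  obtain ⟨hm, hd⟩ := monic_natDegree_prodSubOne a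
  rw [hm.irreducible_iff_natDegree]
  have hpos : 0 < Fintype.card ι := Fintype.card_pos
  refine ⟨fun h => by rw [h, natDegree_one] at hd; omega, fun f g hf hg hfg => ?_⟩
  by_contra! hne
  have hadd : f.natDegree + g.natDegree = Fintype.card ι := by
    rw [← hf.natDegree_mul hg, hfg, hd]
  have heval (i : ι) : (f + g).eval (a i) = 0 := by
    have h : f.eval (a i) * g.eval (a i) = -1 := by
      rw [← eval_mul, hfg, eval_prodSubOne]
    rcases Int.mul_eq_neg_one_iff_eq_one_or_neg_one.1 h with h | h <;> simp [h]
  have hzero : f + g = 0 := by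
    refine eq_zero_of_degree_lt_of_eval_index_eq_zero (v := a) Finset.univ ha.injOn ?_
      fun i _ => heval i
    refine (degree_add_le f g).trans_lt (max_lt ?_ ?_)
    · rw [degree_eq_natDegree hf.ne_zero, Finset.card_univ]; norm_cast; omega
    · rw [degree_eq_natDegree hg.ne_zero, Finset.card_univ]; norm_cast; omega
  have hlead : f.leadingCoeff = (-g).leadingCoeff := by rw [eq_neg_of_add_eq_zero_left hzero]
  rw [leadingCoeff_neg, hf.leadingCoeff, hg.leadingCoeff] at hlead
  norm_num at hlead

/-- If the integers `a i` are at mutual distance at least `5`, then `∏ i, (x - a i) - 1` has a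
real root near each `a i`. -/
theorem exists_real_root_near [Nontrivial ι] {a : ι → ℤ} (ha : ∀ i j, i ≠ j → 5 ≤ |a i - a j|)
    (j : ι) : ∃ r : ℝ, |r - a j| ≤ 1 / 4 ∧ aeval r (prodSubOne a) = 0 := by
  classical
  simp only [aeval_prodSubOne]
  set g : ℝ → ℝ := fun t => ∏ i ∈ Finset.univ.erase j, (t - a i) with hg
  have hfac (t : ℝ) : ∏ i, (t - (a i : ℝ)) = (t - a j) * g t :=
    (Finset.mul_prod_erase _ _ (Finset.mem_univ j)).symm
  have hgc : Continuous g := by fun_prop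
  have hge (t : ℝ) (ht : |t - a j| ≤ 1 / 4) : 4 < |g t| := by
    have hfar (i : ι) (hi : i ∈ Finset.univ.erase j) : 19 / 4 ≤ |t - a i| := by
      have h5 : (5 : ℝ) ≤ |(a j : ℝ) - a i| := by
        exact_mod_cast ha j i (Finset.ne_of_mem_erase hi).symm
      have := abs_sub_le (a j : ℝ) t (a i)
      rw [abs_sub_comm _ t] at this
      linarith
    have hcard : (Finset.univ.erase j).card ≠ 0 := by
      obtain ⟨i, hi⟩ := exists_ne j
      exact Finset.card_ne_zero_of_mem (Finset.mem_erase.2 ⟨hi, Finset.mem_univ i⟩)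
    calc (4 : ℝ) < 19 / 4 := by norm_num
      _ ≤ (19 / 4) ^ (Finset.univ.erase j).card := le_self_pow₀ (by norm_num) hcard
      _ ≤ ∏ i ∈ Finset.univ.erase j, |t - a i| := by
        rw [← Finset.prod_const]
        exact Finset.prod_le_prod (fun _ _ => by norm_num) hfar
      _ = |g t| := (Finset.abs_prod _ _).symm
  have hbound (t : ℝ) (ht : t ∈ Set.Icc (a j - 1 / 4 : ℝ) (a j + 1 / 4)) : |t - a j| ≤ 1 / 4 := by
    rw [abs_le]; constructor <;> linarith [ht.1, ht.2]
  have hle : (a j : ℝ) - 1 / 4 ≤ a j + 1 / 4 := by linarith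
  have hR := hge (a j + 1 / 4) (hbound _ ⟨hle, le_rfl⟩)
  have hL := hge (a j - 1 / 4) (hbound _ ⟨le_rfl, hle⟩)
  have hq : Continuous fun t : ℝ => (t - a j) * g t - 1 := by fun_prop
  have hmid : (fun t : ℝ => (t - a j) * g t - 1) (a j) ≤ 0 := by simp
  simp only [hfac]
  rcases le_or_gt 0 (g (a j + 1 / 4)) with hpos | hneg
  · rw [abs_of_nonneg hpos] at hR
    obtain ⟨t, ht, h0⟩ := intermediate_value_Icc (a := (a j : ℝ)) (b := a j + 1 / 4)
      (by linarith) hq.continuousOn (show (0 : ℝ) ∈ _ from ⟨hmid, by simp; linarith⟩)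
    exact ⟨t, hbound t ⟨by linarith [ht.1], ht.2⟩, h0⟩
  · have hneg' : g (a j - 1 / 4) < 0 := by
      by_contra! hpos
      obtain ⟨t, ht, h0⟩ := intermediate_value_Icc' hle hgc.continuousOn
        (show (0 : ℝ) ∈ _ from ⟨hneg.le, hpos⟩)
      have := hge t (hbound t ht)
      rw [h0] at this
      norm_num at this
    rw [abs_of_neg hneg'] at hL
    obtain ⟨t, ht, h0⟩ := intermediate_value_Icc' (a := (a j : ℝ) - 1 / 4) (b := a j)
      (by linarith) hq.continuousOn (show (0 : ℝ) ∈ _ from ⟨hmid, by simp; linarith⟩)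
    exact ⟨t, hbound t ⟨ht.1, by linarith [ht.2]⟩, h0⟩

/-- A monic polynomial of degree `d` splits at any `d` distinct roots. -/
theorem map_eq_prod_of_injective_roots {A K : Type*} [CommRing A] [Field K] [Algebra A K] {p : A[X]}
    (hp : p.Monic) (hcard : p.natDegree = Fintype.card ι) {r : ι → K}
    (hr : Function.Injective r) (hroot : ∀ i, aeval (r i) p = 0) :
    p.map (algebraMap A K) = ∏ i, (X - C (r i)) := by
  have hm := monic_prod_X_sub_C r Finset.univ
  have hd : (∏ i, (X - C (r i))).natDegree = Fintype.card ι :=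
    natDegree_finsetProd_X_sub_C_eq_card Finset.univ r
  refine eq_of_degree_sub_lt_of_eval_index_eq (v := r) Finset.univ hr.injOn ?_ fun i _ => ?_
  · have hdeg : (p.map (algebraMap A K)).degree = (Fintype.card ι : WithBot ℕ) := by
      rw [hp.degree_map, degree_eq_natDegree, hcard]
      rintro rfl
      exact absurd (hp.map (algebraMap A K)) (by simp)
    have := degree_sub_lt_left (p := p.map (algebraMap A K)) (q := ∏ i, (X - C (r i)))
      (by rw [hdeg, degree_eq_natDegree hm.ne_zero, hd]) (hp.map _).ne_zero
      (by rw [hm.leadingCoeff, (hp.map _).leadingCoeff])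
    rwa [hdeg] at this
  · rw [eval_map_algebraMap, hroot, eval_prod, Finset.prod_eq_zero (Finset.mem_univ i) (by simp)]

/-- Conjugation: a common root of an irreducible monic integer polynomial gives an embedding. -/
theorem exists_ringHom_adjoin {S T : Type*} [Field S] [CharZero S] [CommRing T]
    {p : ℤ[X]} (hp : p.Monic) (hirr : Irreducible p) {x : S} (hx : aeval x p = 0) {y : T}
    (hy : aeval y p = 0) :
    ∃ σ : Algebra.adjoin ℤ ({x} : Set S) →+* T,
      ∀ (f : ℤ[X]) (z : Algebra.adjoin ℤ ({x} : Set S)), (z : S) = aeval x f → σ z = aeval y f := by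
  have hint : IsIntegral ℤ x := ⟨p, hp, hx⟩
  have hmin : minpoly ℤ x = p :=
    eq_of_monic_of_associated (minpoly.monic hint) hp
      ((hirr.dvd_iff.1 (minpoly.isIntegrallyClosed_dvd hint hx)).resolve_left
        (minpoly.not_isUnit ℤ x)).symm
  let τ : AdjoinRoot (minpoly ℤ x) →ₐ[ℤ] T := AdjoinRoot.liftAlgHom _ (Algebra.ofId ℤ T) y
    (by rw [hmin]; exact hy)
  have hcomp : ((Algebra.adjoin ℤ ({x} : Set S)).val.comp
      (minpoly.equivAdjoin hint).toAlgHom).comp (AdjoinRoot.mkₐ (minpoly ℤ x)) = aeval x := by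
    refine Polynomial.algHom_ext ?_
    simp
  refine ⟨(τ : AdjoinRoot (minpoly ℤ x) →+* T).comp
    ((minpoly.equivAdjoin hint).symm : _ →+* AdjoinRoot (minpoly ℤ x)), fun f z hz => ?_⟩
  have hz' : z = minpoly.equivAdjoin hint (AdjoinRoot.mk _ f) :=
    Subtype.ext (hz.trans (DFunLike.congr_fun hcomp f).symm)
  rw [hz']
  change τ ((minpoly.equivAdjoin hint).symm (minpoly.equivAdjoin hint _)) = _
  rw [AlgEquiv.symm_apply_apply]
  simp [τ, aeval_def]

/-- The product of the values of an integer polynomial at all roots of a monic one is an integer. -/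
theorem exists_int_eq_prod_aeval {p : ℤ[X]} (hp : p.Monic) {r : ι → ℝ}
    (hpr : p.map (algebraMap ℤ ℝ) = ∏ i, (X - C (r i))) (f : ℤ[X]) :
    ∃ n : ℤ, (n : ℝ) = ∏ i, aeval (r i) f := by
  refine ⟨p.resultant f, ?_⟩
  have h := resultant_eq_prod_eval (p.map (algebraMap ℤ ℝ)) (f.map (algebraMap ℤ ℝ)) f.natDegree
    natDegree_map_le (by rw [hpr]; exact Splits.prod fun i _ => Splits.X_sub_C _)
  rw [hp.natDegree_map, resultant_map_map, (hp.map _).leadingCoeff, hpr,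
    show ∏ i, (X - C (r i)) = ((Finset.univ.val.map r).map fun t => X - C t).prod by
      rw [Multiset.map_map]; rfl, roots_multiset_prod_X_sub_C] at h
  simpa [aeval_def, eval_map] using h

theorem exists_forall_le_add_one {α : Type*} [Nonempty α] (F : α → ℝ) (hF : ∀ x, 0 ≤ F x) :
    ∃ x, ∀ y, F x ≤ F y + 1 := by
  obtain ⟨x, hx⟩ := exists_lt_of_ciInf_lt (lt_add_one (⨅ y, F y))
  exact ⟨x, fun y => hx.le.trans (by
    gcongr; exact ciInf_le ⟨0, Set.forall_mem_range.2 hF⟩ y)⟩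

/-- Translating `a` by the sum over `S` of the rows of a matrix close to `L • (1 - d • e i)`, if it
does not shorten `a`, bounds the sum of the entries of `a` over `S`. -/
theorem two_mul_sum_le_of_almost_shortest [DecidableEq ι] {E L : ℝ} (hE : 0 ≤ E) (hL : 0 ≤ L)
    {l : ι → ι → ℝ} (hl : ∀ i j, |l i j - L * (1 - if i = j then (Fintype.card ι : ℝ) else 0)| ≤ E)
    {a : ι → ℝ} (ha : ∑ j, a j = 0) (S : Finset ι)
    (hmin : ∑ j, a j ^ 2 ≤ ∑ j, (a j + ∑ i ∈ S, l i j) ^ 2 + 1) :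
    2 * Fintype.card ι * L * ∑ j ∈ S, a j ≤
      L ^ 2 * Fintype.card ι * (S.card * (Fintype.card ι - S.card)) +
        2 * (Fintype.card ι * E) * ∑ j, |a j| +
        2 * L * Fintype.card ι ^ 2 * (Fintype.card ι * E) +
        Fintype.card ι * (Fintype.card ι * E) ^ 2 + 1 := by
  set d : ℝ := (Fintype.card ι : ℝ) with hd
  set s : ℝ := (S.card : ℝ) with hs
  have hsd : s ≤ d := Nat.cast_le.2 S.card_le_univ
  have hs0 : 0 ≤ s := Nat.cast_nonneg _
  let c : ι → ℝ := fun j => s - if j ∈ S then d else 0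
  let e : ι → ℝ := fun j => ∑ i ∈ S, l i j - L * c j
  have hc (j : ι) : |c j| ≤ d := by
    rw [abs_le]; simp only [c]; split_ifs <;> constructor <;> linarith
  have he (j : ι) : |e j| ≤ d * E := by
    have : e j = ∑ i ∈ S, (l i j - L * (1 - if i = j then d else 0)) := by
      simp [e, c, Finset.sum_sub_distrib, ← Finset.mul_sum, s]
    rw [this]
    calc |∑ i ∈ S, (l i j - L * (1 - if i = j then d else 0))| ≤ ∑ i ∈ S, E :=
          (Finset.abs_sum_le_sum_abs _ _).trans (Finset.sum_le_sum fun i _ => hl i j)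
      _ = s * E := by simp [s]
      _ ≤ d * E := by gcongr
  have hac : ∑ j, a j * c j = -d * ∑ j ∈ S, a j := by
    simp only [c, mul_sub, Finset.sum_sub_distrib, ← Finset.sum_mul, ha, mul_ite, mul_zero]
    rw [Finset.sum_ite_mem, Finset.univ_inter, ← Finset.sum_mul]
    ring
  have hcc : ∑ j, c j ^ 2 = d * (s * (d - s)) := by
    have (j : ι) : c j ^ 2 = s ^ 2 + if j ∈ S then d ^ 2 - 2 * s * d else 0 := by
      simp only [c]; split_ifs <;> ring
    simp only [this, Finset.sum_add_distrib, Finset.sum_ite_mem, Finset.univ_inter,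
      Finset.sum_const, nsmul_eq_mul, Finset.card_univ]
    rw [← hd, ← hs]; ring
  have hae : ∑ j, a j * e j ≤ d * E * ∑ j, |a j| := by
    rw [Finset.mul_sum]
    refine Finset.sum_le_sum fun j _ => (le_abs_self _).trans ?_
    rw [abs_mul, mul_comm]
    gcongr
    exact he j
  have hce : ∑ j, c j * e j ≤ d * (d * (d * E)) := by
    calc ∑ j, c j * e j ≤ ∑ _j : ι, d * (d * E) := by
          refine Finset.sum_le_sum fun j _ => (le_abs_self _).trans ?_
          rw [abs_mul]
          gcongr
          exacts [hc j, he j]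
      _ = d * (d * (d * E)) := by simp [hd]
  have hee : ∑ j, e j ^ 2 ≤ d * (d * E) ^ 2 := by
    calc ∑ j, e j ^ 2 ≤ ∑ _j : ι, (d * E) ^ 2 := by
          refine Finset.sum_le_sum fun j _ => ?_
          rw [← sq_abs]
          gcongr
          exact he j
      _ = d * (d * E) ^ 2 := by simp [hd]
  have hexp : ∑ j, (a j + ∑ i ∈ S, l i j) ^ 2 = ∑ j, a j ^ 2 + 2 * L * ∑ j, a j * c j +
      2 * ∑ j, a j * e j + L ^ 2 * ∑ j, c j ^ 2 + 2 * L * ∑ j, c j * e j + ∑ j, e j ^ 2 := by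
    simp only [Finset.mul_sum, ← Finset.sum_add_distrib]
    refine Finset.sum_congr rfl fun j _ => ?_
    rw [show ∑ i ∈ S, l i j = L * c j + e j by simp [e]]
    ring
  rw [hexp, hac, hcc] at hmin
  have := mul_le_mul_of_nonneg_left hce (by positivity : 0 ≤ 2 * L)
  linarith

/-- An almost shortest vector modulo a lattice close to `L` times the one generated by the vectors
`1 - d • e i` is close to the permutohedron, so that its entries are bounded in terms of `L`. -/
theorem exists_le_of_almost_shortest (ι : Type*) [Fintype ι] [DecidableEq ι] {E : ℝ} (hE : 0 ≤ E) :
    ∃ L₀ : ℝ, ∀ L ≥ L₀, ∀ l : ι → ι → ℝ,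
      (∀ i j, |l i j - L * (1 - if i = j then (Fintype.card ι : ℝ) else 0)| ≤ E) →
      ∀ a : ι → ℝ, ∑ j, a j = 0 →
      (∀ S : Finset ι, ∑ j, a j ^ 2 ≤ ∑ j, (a j + ∑ i ∈ S, l i j) ^ 2 + 1) →
      ∀ S : Finset ι, S.Nonempty → S ≠ Finset.univ →
        ∃ j ∈ S, a j ≤ L * (Fintype.card ι - S.card - 1 / 4) := by
  set d : ℝ := (Fintype.card ι : ℝ) with hd
  set E' : ℝ := d * E with hE'
  have hd0 : 0 ≤ d := Nat.cast_nonneg _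
  have hE0 : 0 ≤ E' := by positivity
  set K : ℝ := 22 * d ^ 2 * E' + d * E' + 1 with hK
  have hK0 : 0 < K := by positivity
  refine ⟨4 * E' + 1 + 3 * K, fun L hL l hl a ha hmin S hS hSu => ?_⟩
  have hL1 : 1 ≤ L := by linarith
  have hLE : 4 * E' ≤ L := by linarith
  have hLK : 2 * K < L := by linarith
  have hL0 : 0 < L := by linarith
  have key (S : Finset ι) := two_mul_sum_le_of_almost_shortest hE hL0.le hl ha S (hmin S)
  rw [← hd, ← hE'] at key
  set A : ℝ := ∑ j, |a j| with hA
  have hA0 : 0 ≤ A := Finset.sum_nonneg fun _ _ => abs_nonneg _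
  have hd1 : 1 ≤ d := by
    have : 1 ≤ Fintype.card ι := Fintype.card_pos_iff.2 ⟨hS.choose⟩
    exact Nat.one_le_cast.2 this
  have hAle : A ≤ 10 * d ^ 2 * L := by
    set P := Finset.univ.filter fun j => 0 ≤ a j
    have hAP : A = 2 * ∑ j ∈ P, a j := by
      have h (j : ι) : |a j| = 2 * (if 0 ≤ a j then a j else 0) - a j := by
        split_ifs with h
        · rw [abs_of_nonneg h]; ring
        · rw [abs_of_neg (not_le.1 h)]; ring
      simp only [hA, h, Finset.sum_sub_distrib, ha, ← Finset.mul_sum, P, Finset.sum_filter,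
        sub_zero]
    have hP := key P
    have hp0 : (0 : ℝ) ≤ P.card := Nat.cast_nonneg _
    have hpd : (P.card : ℝ) ≤ d := Nat.cast_le.2 P.card_le_univ
    have h1 : (P.card : ℝ) * (d - P.card) ≤ d ^ 2 := by nlinarith
    have h2 : L ^ 2 * d * (P.card * (d - P.card)) ≤ L ^ 2 * d * d ^ 2 := by gcongr
    have h3 : 2 * E' * A ≤ d * L * A / 2 := by
      have : 4 * E' ≤ d * L := hLE.trans (le_mul_of_one_le_left hL0.le hd1)
      nlinarith
    have h4 : 2 * L * d ^ 2 * E' ≤ 2 * L * d ^ 2 * (d * L) := by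
      gcongr
      nlinarith
    have h5 : d * E' ^ 2 ≤ L ^ 2 * d ^ 3 := by
      calc d * E' ^ 2 ≤ d * L ^ 2 := by gcongr; linarith
        _ ≤ d ^ 3 * L ^ 2 := by gcongr; exact le_self_pow₀ hd1 (by norm_num)
        _ = L ^ 2 * d ^ 3 := by ring
    have h6 : 1 ≤ L ^ 2 * d ^ 3 := one_le_mul_of_one_le_of_one_le (one_le_pow₀ hL1)
      (one_le_pow₀ hd1)
    have h7 : d * L * A ≤ d * L * (10 * d ^ 2 * L) := by
      have : d * L * A = 2 * d * L * ∑ j ∈ P, a j := by rw [hAP]; ring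
      linarith
    exact le_of_mul_le_mul_left h7 (by positivity)
  by_contra! hlt
  set s : ℝ := (S.card : ℝ) with hs
  have hs1 : 1 ≤ s := Nat.one_le_cast.2 hS.card_pos
  have hsd : 1 ≤ d - s := by
    have : S.card + 1 ≤ Fintype.card ι :=
      (Finset.card_lt_iff_ne_univ S).2 hSu
    have : s + 1 ≤ d := by rw [hs, hd]; exact_mod_cast this
    linarith
  have hsum : s * (L * (d - s - 1 / 4)) ≤ ∑ j ∈ S, a j := by
    rw [hs, ← nsmul_eq_mul]
    exact Finset.card_nsmul_le_sum S a _ fun j hj => (hlt j hj).le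
  have hkey := key S
  have h1 : 2 * E' * A ≤ 2 * E' * (10 * d ^ 2 * L) := by gcongr
  have h2 : d * E' ^ 2 ≤ L * (d * E') := by
    have : E' * (d * E') ≤ L * (d * E') := by gcongr; linarith
    linarith
  have h3 : 2 * d * L * (s * (L * (d - s - 1 / 4))) ≤ 2 * d * L * ∑ j ∈ S, a j := by gcongr
  have h4 : L * (d * s * (d - s - 1 / 2) * L) ≤ L * K := by
    rw [hK]
    linarith
  have h5 := le_of_mul_le_mul_left h4 hL0
  have h6 : 1 / 2 * L ≤ d * s * (d - s - 1 / 2) * L := by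
    gcongr
    have : 1 ≤ d * s := one_le_mul_of_one_le_of_one_le hd1 hs1
    nlinarith
  linarith

/-- An integer polynomial of degree less than `d` taking few large values at `d` points far apart is
constant. -/
theorem natDegree_eq_zero_of_small_values [DecidableEq ι] {L : ℝ} {r : ι → ℝ}
    (hL : (Fintype.card ι : ℝ) * 2 ^ Fintype.card ι < Real.exp (L / 4))
    (hr : ∀ i j, i ≠ j → Real.exp L / 2 ≤ |r i - r j|) {f : ℤ[X]}
    (hf : f.natDegree < Fintype.card ι)
    (hsmall : ∀ S : Finset ι, S.Nonempty → S ≠ Finset.univ →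
      ∃ j ∈ S, |aeval (r j) f| ≤ Real.exp (L * (Fintype.card ι - S.card - 1 / 4))) :
    f.natDegree = 0 := by
  by_contra hn
  set n := f.natDegree with hn'
  have hf0 : f ≠ 0 := by rintro rfl; simp at hn'; omega
  have hinj : Function.Injective r := fun i j hij => by
    by_contra hne
    have := hr i j hne
    rw [hij, sub_self, abs_zero] at this
    linarith [Real.exp_pos L]
  set T := Finset.univ.filter fun j => |aeval (r j) f| ≤ Real.exp (L * (n - 1 / 4))
  have hT : n + 1 ≤ T.card := by
    by_contra! hlt
    have hcompl : Fintype.card ι - n ≤ Tᶜ.card := by rw [Finset.card_compl]; omega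
    obtain ⟨S, hST, hS⟩ := Finset.exists_subset_card_eq hcompl
    obtain ⟨j, hj, hle⟩ := hsmall S (Finset.card_pos.1 (by omega)) (by
      rintro rfl; rw [Finset.card_univ] at hS; omega)
    rw [hS, Nat.cast_sub hf.le, sub_sub_cancel] at hle
    exact (Finset.mem_compl.1 (hST hj)) (by simpa [T] using hle)
  obtain ⟨T', hTT, hT'⟩ := Finset.exists_subset_card_eq hT
  have hlead := Lagrange.leadingCoeff_eq_sum (s := T') (v := r) hinj.injOn
    (P := f.map (Int.castRingHom ℝ)) (by
      rw [degree_map_eq_of_injective (RingHom.injective_int _), degree_eq_natDegree hf0, hT']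
      norm_cast)
  rw [leadingCoeff_map_of_injective (RingHom.injective_int _)] at hlead
  have hge : (1 : ℝ) ≤ |(f.leadingCoeff : ℝ)| := by
    exact_mod_cast Int.one_le_abs (leadingCoeff_ne_zero.2 hf0)
  have hterm (i : ι) (hi : i ∈ T') :
      |(f.map (Int.castRingHom ℝ)).eval (r i) / ∏ j ∈ T'.erase i, (r i - r j)| ≤
        2 ^ n * Real.exp (-(L / 4)) := by
    have hnum : |(f.map (Int.castRingHom ℝ)).eval (r i)| ≤ Real.exp (L * (n - 1 / 4)) := by
      simpa [T, aeval_def, eval_map] using hTT hi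
    have hden : (Real.exp L / 2) ^ n ≤ |∏ j ∈ T'.erase i, (r i - r j)| := by
      have hcard : (T'.erase i).card = n := by rw [Finset.card_erase_of_mem hi, hT']; rfl
      rw [Finset.abs_prod, ← hcard, ← Finset.prod_const]
      exact Finset.prod_le_prod (fun _ _ => by positivity) fun j hj =>
        hr i j (Finset.ne_of_mem_erase hj).symm
    rw [abs_div]
    calc _ ≤ Real.exp (L * (n - 1 / 4)) / (Real.exp L / 2) ^ n := by gcongr
      _ = 2 ^ n * Real.exp (-(L / 4)) := by
        rw [div_pow, ← Real.exp_nat_mul, div_div_eq_mul_div, mul_comm, mul_div_assoc,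
          ← Real.exp_sub]
        congr 2
        ring
  have : |(f.leadingCoeff : ℝ)| < 1 := by
    calc |(f.leadingCoeff : ℝ)| ≤ ∑ _i ∈ T', 2 ^ n * Real.exp (-(L / 4)) := by
          rw [show (f.leadingCoeff : ℝ) = _ from hlead]
          exact (Finset.abs_sum_le_sum_abs _ _).trans (Finset.sum_le_sum hterm)
      _ = ((n + 1 : ℕ) : ℝ) * 2 ^ n * Real.exp (-(L / 4)) := by
          rw [Finset.sum_const, hT', nsmul_eq_mul, mul_assoc]
      _ ≤ (Fintype.card ι : ℝ) * 2 ^ Fintype.card ι * Real.exp (-(L / 4)) := by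
          gcongr
          · exact hf
          · norm_num
      _ < Real.exp (L / 4) * Real.exp (-(L / 4)) := by gcongr
      _ = 1 := by rw [← Real.exp_add]; simp
  linarith

/-- The logarithms of the conjugates of `θ - a i` when the `a i` have differences of size comparable
to `exp L`. -/
theorem abs_log_sub_le [DecidableEq ι] {a : ι → ℤ} {r : ι → ℝ} {L M : ℝ} (hL : 1 ≤ Real.exp L)
    (hM : 1 ≤ M) (ha : ∀ i j, i ≠ j →
      Real.exp L ≤ |(a i : ℝ) - a j| ∧ |(a i : ℝ) - a j| ≤ M * Real.exp L)
    (hr : ∀ i, |r i - a i| ≤ 1 / 4) (hprod : ∀ j, ∏ i, (r j - a i) = 1) (i j : ι) :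
    |Real.log |r j - a i| - L * (1 - if i = j then (Fintype.card ι : ℝ) else 0)| ≤
      Fintype.card ι * Real.log (2 * M) := by
  have hlog2 : Real.log 2 ≤ Real.log (2 * M) := Real.log_le_log (by norm_num) (by linarith)
  have hlog0 : 0 ≤ Real.log (2 * M) := (Real.log_nonneg (by norm_num)).trans hlog2
  have hcard : (1 : ℝ) ≤ Fintype.card ι := Nat.one_le_cast.2 (Fintype.card_pos_iff.2 ⟨i⟩)
  have hoff (i : ι) (hij : i ≠ j) : |Real.log |r j - a i| - L| ≤ Real.log (2 * M) := by
    obtain ⟨h1, h2⟩ := ha j i hij.symm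
    have h3 := hr j
    have h4 : |(a j : ℝ) - a i| - |r j - a j| ≤ |r j - a i| := by
      have := abs_sub_le (a j : ℝ) (r j) (a i)
      rw [abs_sub_comm _ (r j)] at this
      linarith
    have h5 := abs_sub_le (r j) (a j) (a i)
    have hlow : Real.exp L / 2 ≤ |r j - a i| := by linarith
    have hup : |r j - a i| ≤ 2 * M * Real.exp L := by
      have : 1 ≤ M * Real.exp L := one_le_mul_of_one_le_of_one_le hM hL
      linarith
    have hpos : 0 < |r j - a i| := by linarith
    have h6 := Real.log_le_log (by positivity) hlow
    have h7 := Real.log_le_log hpos hup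
    rw [Real.log_div (by positivity) (by norm_num), Real.log_exp] at h6
    rw [Real.log_mul (by positivity) (by positivity), Real.log_exp] at h7
    rw [abs_le]
    constructor <;> linarith
  split_ifs with hij
  · subst hij
    have hne (i' : ι) : |r i - a i'| ≠ 0 := by
      have h := hprod i
      intro h0
      rw [Finset.prod_eq_zero (Finset.mem_univ i') (abs_eq_zero.1 h0)] at h
      exact zero_ne_one h
    have hsum : ∑ i', Real.log |r i - a i'| = 0 := by
      rw [← Real.log_prod fun i' _ => hne i', ← Finset.abs_prod, hprod]
      simp
    rw [← Finset.add_sum_erase _ _ (Finset.mem_univ i)] at hsum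
    have hcard' : ((Finset.univ.erase i).card : ℝ) = Fintype.card ι - 1 := by
      rw [Finset.card_erase_of_mem (Finset.mem_univ i), Finset.card_univ,
        Nat.cast_pred (Fintype.card_pos_iff.2 ⟨i⟩)]
    have heq : Real.log |r i - a i| - L * (1 - Fintype.card ι) =
        -∑ i' ∈ Finset.univ.erase i, (Real.log |r i - a i'| - L) := by
      rw [Finset.sum_sub_distrib, Finset.sum_const, nsmul_eq_mul, hcard']
      linarith
    rw [heq, abs_neg]
    calc _ ≤ ∑ i' ∈ Finset.univ.erase i, Real.log (2 * M) :=
          (Finset.abs_sum_le_sum_abs _ _).trans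
            (Finset.sum_le_sum fun i' hi' => hoff i' (Finset.ne_of_mem_erase hi'))
      _ = (Fintype.card ι - 1) * Real.log (2 * M) := by
          rw [Finset.sum_const, nsmul_eq_mul, hcard']
      _ ≤ _ := by gcongr; linarith
  · rw [sub_zero, mul_one]
    exact (hoff i hij).trans (le_mul_of_one_le_left hlog0 hcard)

theorem isUnit_sub_intCast {R : Type*} [CommRing R] {a : ι → ℤ} {x : R}
    (hx : aeval x (prodSubOne a) = 0) (i : ι) : IsUnit (x - (a i : R)) := by
  rw [aeval_prodSubOne, sub_eq_zero] at hx
  exact isUnit_of_dvd_one (hx ▸ Finset.dvd_prod_of_mem (fun i => x - (a i : R)) (Finset.mem_univ i))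

/-- The units `θ - a i` generate the unit group of `ℤ[θ]` up to sign, where `θ` is a root of
`∏ i, (x - a i) - 1`, as soon as the differences of the `a i` are large and of comparable size. -/
theorem exists_forall_closure_eq_top (ι : Type*) [Fintype ι] [Nontrivial ι] {M : ℝ} (hM : 1 ≤ M) :
    ∃ L₀ : ℝ, ∀ L ≥ L₀, ∀ a : ι → ℤ,
      (∀ i j, i ≠ j → Real.exp L ≤ |(a i : ℝ) - a j| ∧ |(a i : ℝ) - a j| ≤ M * Real.exp L) →
      ∀ {r : ι → ℝ}, (∀ i, |r i - a i| ≤ 1 / 4) → (∀ i, aeval (r i) (prodSubOne a) = 0) →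
      ∀ {θ : ℂ}, aeval θ (prodSubOne a) = 0 →
      Subgroup.closure {u : (Algebra.adjoin ℤ ({θ} : Set ℂ))ˣ |
        ((u : Algebra.adjoin ℤ ({θ} : Set ℂ)) : ℂ) = -1 ∨
        ∃ i, ((u : Algebra.adjoin ℤ ({θ} : Set ℂ)) : ℂ) = θ - (a i : ℂ)} = ⊤ := by
  classical
  have hlogM : 0 ≤ Real.log (2 * M) := Real.log_nonneg (by linarith)
  obtain ⟨L₁, hL₁⟩ := exists_le_of_almost_shortest ι
    (E := Fintype.card ι * Real.log (2 * M)) (by positivity)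
  refine ⟨max L₁ (max 1 (4 * (Fintype.card ι * 2 ^ Fintype.card ι))),
    fun L hL a ha r hra hr θ hθ => ?_⟩
  simp only [ge_iff_le, max_le_iff] at hL
  obtain ⟨hLL₁, hL1, hLd⟩ := hL
  have hexp : (Fintype.card ι : ℝ) * 2 ^ Fintype.card ι < Real.exp (L / 4) := by
    have := Real.add_one_le_exp (L / 4)
    linarith
  have hexpL : L + 1 ≤ Real.exp L := Real.add_one_le_exp L
  have hfar (i j : ι) (hij : i ≠ j) : Real.exp L / 2 ≤ |r i - r j| := by
    have h1 := (ha i j hij).1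
    have h2 := abs_sub_le (a i : ℝ) (r i) (a j)
    have h3 := abs_sub_le (r i) (r j) (a j)
    rw [abs_sub_comm _ (r i)] at h2
    linarith [hra i, hra j]
  have hainj : Function.Injective a := fun i j hij => by
    by_contra hne
    have := (ha i j hne).1
    rw [hij, sub_self, abs_zero] at this
    linarith
  have hrinj : Function.Injective r := fun i j hij => by
    by_contra hne
    have := hfar i j hne
    rw [hij, sub_self, abs_zero] at this
    linarith
  obtain ⟨hmonic, hdeg⟩ := monic_natDegree_prodSubOne a
  have hirr := irreducible_prodSubOne hainj
  have hprod (j : ι) : ∏ i, (r j - a i) = 1 := by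
    have := hr j
    rwa [aeval_prodSubOne, sub_eq_zero] at this
  have hfactor := map_eq_prod_of_injective_roots hmonic hdeg hrinj hr
  set R := Algebra.adjoin ℤ ({θ} : Set ℂ)
  choose σ hσ using fun j => exists_ringHom_adjoin hmonic hirr hθ (hr j)
  have hrep (z : R) : ∃ f : ℤ[X], (z : ℂ) = aeval θ f := by
    obtain ⟨f, hf⟩ := (Algebra.adjoin_singleton_eq_range_aeval ℤ θ).le z.2
    exact ⟨f, hf.symm⟩
  have hnormint (z : R) : ∃ n : ℤ, (n : ℝ) = ∏ j, σ j z := by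
    obtain ⟨f, hf⟩ := hrep z
    simp only [fun j => hσ j f z hf]
    exact exists_int_eq_prod_aeval hmonic hfactor f
  have hnorm (u : Rˣ) : ∏ j, |σ j u| = 1 := by
    obtain ⟨n, hn⟩ := hnormint u
    obtain ⟨n', hn'⟩ := hnormint (u⁻¹ : Rˣ)
    have hmul : (n : ℝ) * n' = 1 := by
      rw [hn, hn', ← Finset.prod_mul_distrib]
      exact Finset.prod_eq_one fun j _ => by rw [← map_mul, Units.mul_inv, map_one]
    have hun : IsUnit n := IsUnit.of_mul_eq_one n' (by exact_mod_cast hmul)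
    rw [← Finset.abs_prod, ← hn]
    exact_mod_cast Int.isUnit_iff_abs_eq.1 hun
  have hσ0 (j : ι) (u : Rˣ) : |σ j u| ≠ 0 := abs_ne_zero.2 (u.isUnit.map (σ j)).ne_zero
  set x : R := ⟨θ, Algebra.subset_adjoin rfl⟩
  have hx : aeval x (prodSubOne a) = 0 :=
    Subtype.ext ((aeval_algHom_apply R.val x _).symm.trans hθ)
  choose v hv using fun i => isUnit_sub_intCast hx i
  have hσv (i j : ι) : σ j (v i) = r j - a i := by
    rw [hσ j (X - C (a i)) (v i) (by simp [hv, x])]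
    simp
  set H : Subgroup Rˣ := Subgroup.closure {u : Rˣ | ((u : R) : ℂ) = -1 ∨
    ∃ i, ((u : R) : ℂ) = θ - (a i : ℂ)}
  have hvH (i : ι) : v i ∈ H := Subgroup.subset_closure (Or.inr ⟨i, by simp [hv, x]⟩)
  refine eq_top_iff.2 fun u _ => ?_
  obtain ⟨h, hmin⟩ := exists_forall_le_add_one
    (fun h : H => ∑ j, Real.log |σ j ((u * h : Rˣ) : R)| ^ 2) fun h =>
      Finset.sum_nonneg fun j _ => sq_nonneg _
  set w : Rˣ := u * h with hw
  have hsum : ∑ j, Real.log |σ j w| = 0 := by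
    rw [← Real.log_prod fun j _ => hσ0 j w, hnorm, Real.log_one]
  have hshort (S : Finset ι) : ∑ j, Real.log |σ j w| ^ 2 ≤
      ∑ j, (Real.log |σ j w| + ∑ i ∈ S, Real.log |r j - a i|) ^ 2 + 1 := by
    have hm := hmin (h * ⟨∏ i ∈ S, v i, H.prod_mem fun i _ => hvH i⟩)
    refine hm.trans_eq ?_
    congr 1
    refine Finset.sum_congr rfl fun j _ => ?_
    rw [Subgroup.coe_mul, ← mul_assoc, ← hw, Units.val_mul, map_mul, abs_mul,
      Real.log_mul (hσ0 j w) (hσ0 j _), Units.coe_prod, map_prod, Finset.abs_prod,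
      Real.log_prod fun i _ => hσ0 j (v i)]
    simp only [hσv]
  obtain ⟨f', hf'⟩ := hrep w
  set f := f' %ₘ prodSubOne a with hf
  have hwf : ((w : R) : ℂ) = aeval θ f := by
    rw [hf', hf, aeval_modByMonic_eq_self_of_root hθ]
  have hfdeg : f.natDegree < Fintype.card ι := by
    rw [← hdeg]
    refine natDegree_modByMonic_lt _ hmonic fun h1 => ?_
    rw [h1, natDegree_one] at hdeg
    exact Fintype.card_ne_zero hdeg.symm
  have hconst : f.natDegree = 0 := by
    refine natDegree_eq_zero_of_small_values hexp hfar hfdeg fun S hS hSu => ?_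
    obtain ⟨j, hj, hle⟩ := hL₁ L hLL₁ (fun i j => Real.log |r j - a i|)
      (abs_log_sub_le (by linarith) hM ha hra hprod) (fun j => Real.log |σ j w|) hsum hshort S hS hSu
    refine ⟨j, hj, ?_⟩
    rw [← hσ j f w hwf]
    exact (Real.log_le_iff_le_exp (abs_pos.2 (abs_ne_zero.1 (hσ0 j w)))).1 hle
  obtain ⟨n, hn⟩ := natDegree_eq_zero.1 hconst
  rw [← hn] at hwf
  have hn1 : |(n : ℝ)| = 1 := by
    have := hnorm w
    simp only [fun j => hσ j (C n) w hwf, aeval_C, Finset.prod_const, Finset.card_univ] at this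
    exact (pow_eq_one_iff_of_nonneg (abs_nonneg _) Fintype.card_ne_zero).1 (by simpa using this)
  have hwH : w ∈ H := by
    rcases (abs_eq zero_le_one).1 (show |n| = 1 by exact_mod_cast hn1) with rfl | rfl
    · have : w = 1 := Units.ext (Subtype.ext (by simpa using hwf))
      exact this ▸ H.one_mem
    · exact Subgroup.subset_closure (Or.inl (by simpa using hwf))
  exact (H.mul_mem_cancel_right h.2).1 hwH

end

theorem stmt2 (d : ℕ) (hd : 2 ≤ d) (m : Fin d → ℤ) (hm : Function.Injective m)
    (θ : ℕ → ℂ) (hroot : ∀ k, Polynomial.aeval (θ k) (pPoly d m k) = 0) :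
    ∃ N : ℕ, ∀ k ≥ N,
      Irreducible ((pPoly d m k).map (Int.castRingHom ℚ)) ∧
      ((pPoly d m k).map (Int.castRingHom ℚ)).natDegree = d ∧
      (∀ z : ℂ, Polynomial.aeval z (pPoly d m k) = 0 → z.im = 0) ∧
      (∀ i : Fin d, ∃ u : (Algebra.adjoin ℤ ({θ k} : Set ℂ))ˣ,
        ((u : Algebra.adjoin ℤ ({θ k} : Set ℂ)) : ℂ) = θ k - (k : ℂ) * (m i : ℂ)) ∧
      Subgroup.closure
          {u : (Algebra.adjoin ℤ ({θ k} : Set ℂ))ˣ |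
            ((u : Algebra.adjoin ℤ ({θ k} : Set ℂ)) : ℂ) = -1 ∨
            ∃ i : Fin d, ((u : Algebra.adjoin ℤ ({θ k} : Set ℂ)) : ℂ) =
              θ k - (k : ℂ) * (m i : ℂ)} = ⊤ := by
  have : Nontrivial (Fin d) := Fin.nontrivial_iff_two_le.2 hd
  have hp (k : ℕ) : pPoly d m k = prodSubOne fun i => (k : ℤ) * m i := rfl
  set M : ℝ := 1 + ∑ i, ∑ j, |(m i : ℝ) - m j|
  have hmM (i j : Fin d) : |(m i : ℝ) - m j| ≤ M := by
    have h1 := Finset.single_le_sum (f := fun j => |(m i : ℝ) - m j|)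
      (fun _ _ => abs_nonneg _) (Finset.mem_univ j)
    have h2 := Finset.single_le_sum (f := fun i => ∑ j, |(m i : ℝ) - m j|)
      (fun _ _ => Finset.sum_nonneg fun _ _ => abs_nonneg _) (Finset.mem_univ i)
    exact (h1.trans h2).trans (by simp [M])
  have hM : 1 ≤ M := le_add_of_nonneg_right (by positivity)
  obtain ⟨L₀, hL₀⟩ := exists_forall_closure_eq_top (Fin d) hM
  have hlog := (Real.tendsto_log_atTop.comp tendsto_natCast_atTop_atTop).eventually_ge_atTop L₀
  refine Filter.eventually_atTop.1 ?_
  filter_upwards [hlog, Filter.eventually_ge_atTop 5] with k hkL hk5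
  have hk0 : (0 : ℝ) < k := by exact_mod_cast (by omega : 0 < k)
  have hm1 (i j : Fin d) (hij : i ≠ j) : 1 ≤ |m i - m j| :=
    Int.one_le_abs (sub_ne_zero.2 (hm.ne hij))
  have hinj : Function.Injective fun i => (k : ℤ) * m i := fun i j hij =>
    hm (mul_left_cancel₀ (by omega) hij)
  have hsep (i j : Fin d) (hij : i ≠ j) : 5 ≤ |(k : ℤ) * m i - k * m j| := by
    rw [← mul_sub, abs_mul, Nat.abs_cast]
    have := hm1 i j hij
    nlinarith
  have hgap (i j : Fin d) (hij : i ≠ j) :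
      Real.exp (Real.log k) ≤ |(((k : ℤ) * m i : ℤ) : ℝ) - ((k : ℤ) * m j : ℤ)| ∧
      |(((k : ℤ) * m i : ℤ) : ℝ) - ((k : ℤ) * m j : ℤ)| ≤ M * Real.exp (Real.log k) := by
    have h1 : (1 : ℝ) ≤ |(m i : ℝ) - m j| := by exact_mod_cast hm1 i j hij
    rw [Real.exp_log hk0]
    push_cast
    rw [← mul_sub, abs_mul, Nat.abs_cast, mul_comm M]
    exact ⟨le_mul_of_one_le_right hk0.le h1, by gcongr; exact hmM i j⟩
  have hroot' := hroot k
  rw [hp] at hroot' ⊢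
  obtain ⟨hmonic, hdeg⟩ := monic_natDegree_prodSubOne fun i => (k : ℤ) * m i
  choose r hra hr using exists_real_root_near hsep
  have hrinj : Function.Injective r := fun i j hij => by
    by_contra hne
    have h5 : (5 : ℝ) ≤ |(((k : ℤ) * m i : ℤ) : ℝ) - ((k : ℤ) * m j : ℤ)| := by
      exact_mod_cast hsep i j hne
    have h1 := hra i
    have h2 := hra j
    have h3 := abs_sub_le (((k : ℤ) * m i : ℤ) : ℝ) (r i) ((k : ℤ) * m j : ℤ)
    rw [abs_sub_comm _ (r i)] at h3
    rw [hij] at h1 h3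
    linarith
  refine ⟨(hmonic.irreducible_iff_irreducible_map_fraction_map (K := ℚ)).1
      (irreducible_prodSubOne hinj), ?_, fun z hz => ?_, fun i => ?_, ?_⟩
  · rw [hmonic.natDegree_map, hdeg, Fintype.card_fin]
  · have hfac := map_eq_prod_of_injective_roots (K := ℂ) hmonic hdeg
      (r := fun i => (r i : ℂ)) (Complex.ofReal_injective.comp hrinj) fun i => by
        have := congrArg (algebraMap ℝ ℂ) (hr i)
        rwa [← aeval_algebraMap_apply, map_zero] at this
    rw [← eval_map_algebraMap, hfac, eval_prod, Finset.prod_eq_zero_iff] at hz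
    obtain ⟨i, -, hi⟩ := hz
    rw [eval_sub, eval_X, eval_C, sub_eq_zero] at hi
    rw [hi, Complex.ofReal_im]
  · have hx : aeval (⟨θ k, Algebra.subset_adjoin rfl⟩ : Algebra.adjoin ℤ ({θ k} : Set ℂ))
        (prodSubOne fun i => (k : ℤ) * m i) = 0 :=
      Subtype.ext ((aeval_algHom_apply (Algebra.adjoin ℤ {θ k}).val _ _).symm.trans hroot')
    obtain ⟨u, hu⟩ := isUnit_sub_intCast hx i
    exact ⟨u, by simp [hu]⟩
  · simpa using hL₀ (Real.log k) hkL _ hgap hra hr hroot'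
end
end

section
/- Fix M > 1 and κ ∈ (0,1). Let x ∈ Ω_M with M-tight simplex set Φ, and assume ρ = |Δ_x|^{κ/n}/ξ_Φ < 1. Then for every t ∈ (1−ρ)(n/2)S_Φ + Δ_Φ one has ℓ(a(t)x) ≤ δ, where δ = M e^{−(n/2)|Δ_x|^{κ/n}}. -/
open scoped Pointwise

noncomputable section

/-- The hyperplane `ℝ^d_0` of zero coordinate sum, as a set. -/
def V0 (d : ℕ) : Set (Fin d → ℝ) := {t | ∑ i, t i = 0}

/-- The hyperplane `ℝ^d_0`, as a submodule. -/
def V0sub (d : ℕ) : Submodule ℝ (Fin d → ℝ) :=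
  LinearMap.ker (∑ i : Fin d, LinearMap.proj i)

/-- A simplex set: `d` vectors in `ℝ^d_0` summing to zero and spanning `ℝ^d_0`. -/
structure SimplexSet (d : ℕ) where
  elems : Finset (Fin d → ℝ)
  card_eq : elems.card = d
  sum_eq_zero : elems.sum id = 0
  span_eq : Submodule.span ℝ (elems : Set (Fin d → ℝ)) = V0sub d

/-- The lattice `Δ_Φ` associated to a simplex set. -/
def latticeOfSS {d : ℕ} (Φ : SimplexSet d) : AddSubgroup (Fin d → ℝ) :=
  AddSubgroup.closure (Φ.elems : Set (Fin d → ℝ))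

/-- `⌈t⌉ = max_i t_i`. -/
def ceilMax {d : ℕ} (t : Fin d → ℝ) : ℝ := ⨆ i, t i

/-- `ξ_Φ = max_{t ∈ Φ} ⌈t⌉`. -/
def xi {d : ℕ} (Φ : SimplexSet d) : ℝ :=
  sSup (ceilMax '' (Φ.elems : Set (Fin d → ℝ)))

/-- Square root of the absolute Gram determinant of a `(d-1)`-tuple of vectors. -/
def gram (d : ℕ) (v : Fin (d - 1) → (Fin d → ℝ)) : ℝ :=
  Real.sqrt |(Matrix.of fun i j : Fin (d - 1) => ∑ k, v i k * v j k).det|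

/-- The (euclidean) covolume of the lattice generated by a set `S ⊆ ℝ^d_0` of rank `d-1`:
the common value of the Gram determinant over all `(d-1)`-tuples generating the same
subgroup as `S`. -/
def covolSet (d : ℕ) (S : Set (Fin d → ℝ)) : ℝ :=
  sInf {r | ∃ v : Fin (d - 1) → (Fin d → ℝ),
      AddSubgroup.closure (Set.range v) = AddSubgroup.closure S ∧ r = gram d v}

/-- The covolume `|Δ_Φ|`. -/
def covolSS {d : ℕ} (Φ : SimplexSet d) : ℝ := covolSet d (Φ.elems : Set (Fin d → ℝ))

/-- The set `φ(stab_{UA}(x))` of logarithmic stabilizer times. -/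
def stabSet (d : ℕ) (x : XSpace d) : Set (Fin d → ℝ) :=
  {t | (∑ i, t i = 0) ∧ ∃ ε : Fin d → ℝ, (∀ i, ε i = 1 ∨ ε i = -1) ∧
      (fun v => (Matrix.diagonal fun i => ε i * Real.exp (t i)).mulVec v) '' latticeOf d x
        = latticeOf d x}

/-- The lattice `Δ_x = φ(stab_{UA}(x))`. -/
def DeltaX (d : ℕ) (x : XSpace d) : AddSubgroup (Fin d → ℝ) :=
  AddSubgroup.closure (stabSet d x)

/-- The covolume `|Δ_x|`. -/
def covolX (d : ℕ) (x : XSpace d) : ℝ := covolSet d (stabSet d x)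

/-- `Φ` is an `M`-tight simplex set for `x`. -/
def IsTight (d : ℕ) (M : ℝ) (x : XSpace d) (Φ : SimplexSet d) : Prop :=
  (Φ.elems : Set (Fin d → ℝ)) ⊆ (DeltaX d x : Set (Fin d → ℝ)) ∧
  shortest d x ≤ M * Real.exp (-((d - 1 : ℝ) / 2) * xi Φ)

/-- `Ω_M`: points of `Ω` admitting an `M`-tight simplex set. -/
def OmegaM (d : ℕ) (M : ℝ) : Set (XSpace d) :=
  {x | IsCompact (Aorbit d x) ∧ ∃ Φ : SimplexSet d, IsTight d M x Φ}

/-- The standard simplex set vectors `b_j` (with `-(d-1)` in coordinate `j`, `1` elsewhere). -/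
def bstar (d : ℕ) (j : Fin d) : Fin d → ℝ := fun i => if i = j then -(d - 1 : ℝ) else 1

/-- The points `w_τ^{Φ_*} = τ(d⁻¹ ∑_ℓ (ℓ-1) b_ℓ)`. -/
def wStar (d : ℕ) (τ : Equiv.Perm (Fin d)) : Fin d → ℝ :=
  fun i => (d : ℝ)⁻¹ * ∑ ℓ : Fin d, (ℓ : ℝ) * bstar d ℓ (τ.symm i)

/-- `h` is a distortion map for `Φ`: a linear map with `h Φ_* = |Δ_Φ|^{-1/(d-1)} Φ`. -/
def IsDistortion {d : ℕ} (Φ : SimplexSet d) (h : (Fin d → ℝ) →ₗ[ℝ] (Fin d → ℝ)) : Prop :=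
  h '' Set.range (bstar d) =
    (fun v => (covolSS Φ) ^ (-(1 : ℝ) / (d - 1 : ℝ)) • v) '' (Φ.elems : Set (Fin d → ℝ))

/-- `w_τ^Φ = |Δ_Φ|^{1/(d-1)} h_Φ (w_τ^{Φ_*})`. -/
def wPhi {d : ℕ} (Φ : SimplexSet d) (h : (Fin d → ℝ) →ₗ[ℝ] (Fin d → ℝ))
    (τ : Equiv.Perm (Fin d)) : Fin d → ℝ :=
  (covolSS Φ) ^ ((1 : ℝ) / (d - 1 : ℝ)) • h (wStar d τ)

/-- `S'` is a set of representatives for the cosets `𝒮 / ⟨θ⟩`, `θ` the cyclic rotation. -/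
def IsRepSet (d : ℕ) (S' : Set (Equiv.Perm (Fin d))) : Prop :=
  ∀ τ : Equiv.Perm (Fin d), ∃! σ, σ ∈ S' ∧ τ⁻¹ * σ ∈ Subgroup.zpowers (finRotate d)

/-- The closed ball of radius `r` in `ℝ^d_0`. -/
def ballV0 (d : ℕ) (r : ℝ) : Set (Fin d → ℝ) := {t | (∑ i, t i = 0) ∧ ‖t‖ ≤ r}

/-- Operator norm of a matrix with respect to the supremum norm. -/
def opNorm (d : ℕ) (g : Matrix (Fin d) (Fin d) ℝ) : ℝ :=
  sSup {r | ∃ v : Fin d → ℝ, ‖v‖ ≤ 1 ∧ r = ‖g.mulVec v‖}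

/-- Operator norm of a linear map restricted to the hyperplane `ℝ^d_0`. -/
def normOnV0 (d : ℕ) (h : (Fin d → ℝ) →ₗ[ℝ] (Fin d → ℝ)) : ℝ :=
  sSup {r | ∃ v : Fin d → ℝ, (∑ i, v i = 0) ∧ ‖v‖ ≤ 1 ∧ r = ‖h v‖}

/-- `Ω_M(ε, C)`. -/
def OmegaMEC (d : ℕ) (M ε C : ℝ) : Set (XSpace d) :=
  {x | IsCompact (Aorbit d x) ∧ ∃ Φ : SimplexSet d, IsTight d M x Φ ∧
    ∃ h, IsDistortion Φ h ∧
      ∀ τ : Equiv.Perm (Fin d), ∃ (hw : ∑ i, wPhi Φ h τ i = 0)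
        (g : SLR d) (s : Fin d → ℝ) (hs : ∑ i, s i = 0),
        opNorm d ((g : Matrix (Fin d) (Fin d) ℝ) - 1) ≤ C * Real.exp (-(covolX d x) ^ ε) ∧
        aSL d (wPhi Φ h τ) hw • x = (g * aSL d s hs) • stdLat d}

/-- Homothety–`GL(ℤ)` equivalence of `(d-1)`-tuples: same lattice shape. -/
def shapeRel (d : ℕ) (v w : Fin (d - 1) → (Fin d → ℝ)) : Prop :=
  ∃ c : ℝ, 0 < c ∧ ∃ g : Matrix (Fin (d - 1)) (Fin (d - 1)) ℤ, IsUnit g.det ∧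
    ∀ i, w i = c • ∑ j, ((g i j : ℝ) • v j)

/-- The space of shapes of lattices in `ℝ^d_0` (with the quotient topology). -/
def ShapeSpace (d : ℕ) := Quot (shapeRel d)

instance (d : ℕ) : TopologicalSpace (ShapeSpace d) :=
  instTopologicalSpaceQuot

/-- The shape of the lattice generated by a tuple. -/
def shapeOf (d : ℕ) (v : Fin (d - 1) → (Fin d → ℝ)) : ShapeSpace d := Quot.mk _ v

/-- An enumeration of the elements of a simplex set. -/
def ssEnum {d : ℕ} (Φ : SimplexSet d) : Fin d → (Fin d → ℝ) :=
  fun i => ((Φ.elems.equivFin.symm (finCongr Φ.card_eq.symm i)) : Fin d → ℝ)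

/-- The shape of `Δ_Φ` (generated by the first `d-1` elements of `Φ`). -/
def shapeOfSS {d : ℕ} (Φ : SimplexSet d) : ShapeSpace d :=
  shapeOf d fun i : Fin (d - 1) => ssEnum Φ (Fin.castLE (Nat.sub_le d 1) i)

/-- `Ω_{M,K}`. -/
def OmegaMK (d : ℕ) (M : ℝ) (K : Set (ShapeSpace d)) : Set (XSpace d) :=
  {x | IsCompact (Aorbit d x) ∧ ∃ Φ : SimplexSet d, IsTight d M x Φ ∧ shapeOfSS Φ ∈ K}

theorem smul_mem_latticeOf {d : ℕ} (g : SLR d) {x : XSpace d} {w : Fin d → ℝ}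
    (hw : w ∈ latticeOf d x) :
    (g : Matrix (Fin d) (Fin d) ℝ).mulVec w ∈ latticeOf d (g • x) := by
  obtain ⟨h, rfl, v, rfl⟩ := hw
  exact ⟨g * h, rfl, v, by rw [Matrix.mulVec_mulVec, Matrix.SpecialLinearGroup.coe_mul]⟩

theorem exists_ne_zero_mem_latticeOf {d : ℕ} (hd : 0 < d) (x : XSpace d) :
    ∃ w ∈ latticeOf d x, w ≠ 0 := by
  obtain ⟨g, rfl⟩ := QuotientGroup.mk_surjective x
  refine ⟨_, ⟨g, rfl, fun _ => 1, rfl⟩, fun h => ?_⟩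
  have hdet : (g : Matrix (Fin d) (Fin d) ℝ).det ≠ 0 := by simp
  have h0 := congrFun (Matrix.eq_zero_of_mulVec_eq_zero hdet h) ⟨0, hd⟩
  simp at h0

theorem shortest_le_norm {d : ℕ} {x : XSpace d} {w : Fin d → ℝ}
    (hw : w ∈ latticeOf d x) (hw0 : w ≠ 0) : shortest d x ≤ ‖w‖ :=
  csInf_le ⟨0, by rintro _ ⟨v, -, -, rfl⟩; exact norm_nonneg v⟩ ⟨w, hw, hw0, rfl⟩

theorem shortest_le_mul_shortest {d : ℕ} (hd : 0 < d) {x y : XSpace d} {K : ℝ} (hK : 0 < K)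
    (h : ∀ w ∈ latticeOf d x, w ≠ 0 → shortest d y ≤ K * ‖w‖) :
    shortest d y ≤ K * shortest d x := by
  rw [← div_le_iff₀' hK]
  obtain ⟨w, hw, hw0⟩ := exists_ne_zero_mem_latticeOf hd x
  refine le_csInf ⟨_, w, hw, hw0, rfl⟩ ?_
  rintro _ ⟨v, hv, hv0, rfl⟩
  rw [div_le_iff₀' hK]
  exact h v hv hv0

/-- The logarithmic stabilizer times already form a group. -/
theorem DeltaX_subset_stabSet (d : ℕ) (x : XSpace d) :
    (DeltaX d x : Set (Fin d → ℝ)) ⊆ stabSet d x := by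
  intro t ht
  induction ht using AddSubgroup.closure_induction with
  | mem t ht => exact ht
  | zero => exact ⟨by simp, fun _ => 1, by simp, by simp⟩
  | add s t _ _ hs ht =>
    obtain ⟨hs0, ε, hε, hsL⟩ := hs
    obtain ⟨ht0, η, hη, htL⟩ := ht
    refine ⟨by simp [Finset.sum_add_distrib, hs0, ht0], fun i => ε i * η i, fun i => ?_, ?_⟩
    · rcases hε i with h | h <;> rcases hη i with h' | h' <;> simp [h, h']
    · nth_rewrite 2 [← hsL]
      nth_rewrite 2 [← htL]
      rw [Set.image_image]
      refine Set.image_congr fun v _ => ?_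
      ext i
      simp only [Matrix.mulVec_diagonal, Pi.add_apply, Real.exp_add]
      ring
  | neg t _ ht =>
    obtain ⟨ht0, ε, hε, htL⟩ := ht
    refine ⟨by simp [ht0], ε, hε, ?_⟩
    nth_rewrite 1 [← htL]
    rw [Set.image_image]
    convert Set.image_id _ using 1
    refine Set.image_congr fun v _ => ?_
    ext i
    have hε' : ε i * ε i = 1 := by rcases hε i with h | h <;> simp [h]
    have hexp : Real.exp (-t i) * Real.exp (t i) = 1 := by rw [← Real.exp_add]; simp
    simp only [Matrix.mulVec_diagonal, Pi.neg_apply, id]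
    linear_combination (Real.exp (-t i) * Real.exp (t i) * v i) * hε' + v i * hexp

theorem le_xi {d : ℕ} (Φ : SimplexSet d) {v : Fin d → ℝ} (hv : v ∈ Φ.elems) (i : Fin d) :
    v i ≤ xi Φ :=
  (le_ciSup (f := v) (Set.finite_range _).bddAbove i).trans
    (le_csSup (Φ.elems.finite_toSet.image _).bddAbove ⟨v, hv, rfl⟩)

theorem le_xi_of_mem_convexHull {d : ℕ} (Φ : SimplexSet d) {s : Fin d → ℝ}
    (hs : s ∈ convexHull ℝ (Φ.elems : Set (Fin d → ℝ))) (i : Fin d) : s i ≤ xi Φ := by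
  have hc : Convex ℝ {v : Fin d → ℝ | v i ≤ xi Φ} :=
    convex_halfSpace_le (LinearMap.proj (R := ℝ) (φ := fun _ : Fin d => ℝ) i).isLinear _
  exact convexHull_min (fun v hv => le_xi Φ hv i) hc hs

theorem xi_pos {d : ℕ} (hd : 2 ≤ d) (Φ : SimplexSet d) : 0 < xi Φ := by
  obtain ⟨v, hv, hv0⟩ := Finset.exists_mem_ne (by rw [Φ.card_eq]; omega) (0 : Fin d → ℝ)
  have hsum : ∑ i, v i = 0 := by
    have h : v ∈ V0sub d := Φ.span_eq ▸ Submodule.subset_span hv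
    simpa [V0sub] using h
  obtain ⟨j, hj⟩ := Function.ne_iff.mp hv0
  obtain ⟨i, -, hi⟩ := Finset.exists_pos_of_sum_zero_of_exists_nonzero v hsum
    ⟨j, Finset.mem_univ j, hj⟩
  exact hi.trans_le (le_xi Φ hv i)

theorem shortest_aSL_smul_le {d : ℕ} (hd : 0 < d) {x : XSpace d} {s l : Fin d → ℝ} {c : ℝ}
    (hs : ∀ i, s i ≤ c) (hl : l ∈ stabSet d x) (ht : ∑ i, (s + l) i = 0) :
    shortest d (aSL d (s + l) ht • x) ≤ Real.exp c * shortest d x := by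
  obtain ⟨-, ε, hε, hL⟩ := hl
  refine shortest_le_mul_shortest hd (Real.exp_pos c) fun w hw hw0 => ?_
  rw [← hL] at hw
  obtain ⟨v, hv, rfl⟩ := hw
  have hcoord : ∀ i, (aSL d (s + l) ht : Matrix (Fin d) (Fin d) ℝ).mulVec v i =
      Real.exp (s i) * (Real.exp (l i) * v i) := fun i => by
    simp only [aSL, Matrix.mulVec_diagonal, Pi.add_apply, Real.exp_add]
    ring
  refine (shortest_le_norm (smul_mem_latticeOf _ hv) fun h => hw0 ?_).trans ?_
  · ext i
    have hi := (hcoord i).symm.trans (congrFun h i)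
    simp only [Pi.zero_apply, mul_eq_zero, Real.exp_ne_zero, false_or] at hi
    simp [Matrix.mulVec_diagonal, hi]
  · refine (pi_norm_le_iff_of_nonneg (by positivity)).2 fun i => ?_
    have hsign : ‖ε i‖ = 1 := by rcases hε i with h | h <;> simp [h]
    have hw := norm_le_pi_norm ((Matrix.diagonal fun i => ε i * Real.exp (l i)).mulVec v) i
    rw [Matrix.mulVec_diagonal, mul_assoc, norm_mul, hsign, one_mul] at hw
    rw [hcoord, norm_mul, Real.norm_of_nonneg (Real.exp_pos _).le]
    exact mul_le_mul (Real.exp_le_exp.2 (hs i)) hw (norm_nonneg _) (Real.exp_pos _).le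

theorem stmt4 (d : ℕ) (hd : 2 ≤ d) (M κ : ℝ) (hM : 1 < M) (hκ0 : 0 < κ) (hκ1 : κ < 1)
    (x : XSpace d) (hx : IsCompact (Aorbit d x)) (Φ : SimplexSet d)
    (hΦ : IsTight d M x Φ)
    (hρ : (covolX d x) ^ (κ / (d - 1 : ℝ)) / xi Φ < 1) :
    ∀ (t : Fin d → ℝ) (ht : ∑ i, t i = 0),
      t ∈ ((1 - (covolX d x) ^ (κ / (d - 1 : ℝ)) / xi Φ) * ((d - 1 : ℝ) / 2)) •
            convexHull ℝ (Φ.elems : Set (Fin d → ℝ)) +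
          (latticeOfSS Φ : Set (Fin d → ℝ)) →
      shortest d (aSL d t ht • x) ≤
        M * Real.exp (-((d - 1 : ℝ) / 2) * (covolX d x) ^ (κ / (d - 1 : ℝ))) := by
  rintro t ht ⟨_, ⟨s, hs, rfl⟩, l, hl, rfl⟩
  have hξ := xi_pos hd Φ
  have hd' : (2 : ℝ) ≤ d := by exact_mod_cast hd
  have hl' : l ∈ stabSet d x :=
    DeltaX_subset_stabSet d x ((AddSubgroup.closure_le _).2 hΦ.1 hl)
  refine (shortest_aSL_smul_le (by omega)
    (fun i => mul_le_mul_of_nonneg_left (le_xi_of_mem_convexHull Φ hs i)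
      (mul_nonneg (sub_nonneg.2 hρ.le) (by linarith))) hl' ht).trans ?_
  refine (mul_le_mul_of_nonneg_left hΦ.2 (Real.exp_pos _).le).trans_eq ?_
  rw [mul_left_comm, ← Real.exp_add]
  congr 2
  field_simp
  ring
end
end
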